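/- Let C be a closed convex subset of X, let A be a path-connected subset of E, and let B be the union of all Y-geodesics [x,y]_Y over all pairs of points x, y ∈ A. If A ⊆ C, then B ⊆ C. -/

import Mathlib

open Set Metric Filter

noncomputable section

namespace Cat2Cx

/-! ### Comparison angles -/

/-- Inverse hyperbolic cosine. -/
def arcosh (x : ℝ) : ℝ := Real.log (x + Real.sqrt (x ^ 2 - 1))

/-- The Euclidean comparison angle at the vertex of a (comparison) triangle whose adjacent
sides have lengths `a`, `b` and whose opposite side has length `c`, via the law of cosines. -/
def euclCompAngle (a b c : ℝ) : ℝ :=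
  Real.arccos ((a ^ 2 + b ^ 2 - c ^ 2) / (2 * a * b))

/-- The comparison angle in the model plane `M_κ²` of constant curvature `κ ≤ 0`, via the
(Euclidean or hyperbolic) law of cosines. -/
def compAngle (κ a b c : ℝ) : ℝ :=
  if κ = 0 then euclCompAngle a b c
  else
    Real.arccos
      ((Real.cosh (Real.sqrt (-κ) * a) * Real.cosh (Real.sqrt (-κ) * b) -
          Real.cosh (Real.sqrt (-κ) * c)) /
        (Real.sinh (Real.sqrt (-κ) * a) * Real.sinh (Real.sqrt (-κ) * b)))

variable {Z : Type*}

/-! ### Geodesics with respect to a distance function -/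

/-- `f` restricted to `[a,b]` is a unit-speed geodesic for the distance function `d`
(an isometric embedding of the compact interval `[a,b]`). -/
def IsGeodesicWrt (d : Z → Z → ℝ) (f : ℝ → Z) (a b : ℝ) : Prop :=
  a ≤ b ∧ ∀ s ∈ Icc a b, ∀ t ∈ Icc a b, d (f s) (f t) = |s - t|

/-- `f` is a unit-speed geodesic from `x` to `y` (for the distance function `d`),
staying inside `S`. -/
def IsGeodesicFromTo (d : Z → Z → ℝ) (S : Set Z) (f : ℝ → Z) (x y : Z) : Prop :=
  f 0 = x ∧ f (d x y) = y ∧ IsGeodesicWrt d f 0 (d x y) ∧ MapsTo f (Icc 0 (d x y)) S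

/-- `S`, with the distance function `d`, is a geodesic space. -/
def GeodesicSpaceWrt (d : Z → Z → ℝ) (S : Set Z) : Prop :=
  ∀ x ∈ S, ∀ y ∈ S, ∃ f, IsGeodesicFromTo d S f x y

/-- The geodesic segment `[x,y]`: the union of (the images of) all geodesics from `x` to `y`
inside `S`.  In a uniquely geodesic space this is the image of the unique geodesic. -/
def geodSeg (d : Z → Z → ℝ) (S : Set Z) (x y : Z) : Set Z :=
  ⋃ f ∈ {f : ℝ → Z | IsGeodesicFromTo d S f x y}, f '' Icc 0 (d x y)

/-- `C ⊆ S` is geodesically convex with respect to `d`: every geodesic (in `S`) between two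
points of `C` lies in `C`. -/
def ConvexWrtIn (d : Z → Z → ℝ) (S C : Set Z) : Prop :=
  ∀ x ∈ C, ∀ y ∈ C, geodSeg d S x y ⊆ C

/-- `C` is geodesically convex with respect to `d`. -/
abbrev ConvexWrt (d : Z → Z → ℝ) (C : Set Z) : Prop := ConvexWrtIn d univ C

/-- The geodesically convex hull of `A` with respect to `d`. -/
def convexHullWrt (d : Z → Z → ℝ) (A : Set Z) : Set Z :=
  ⋂₀ {C | ConvexWrt d C ∧ A ⊆ C}

/-- The Alexandrov (upper) angle at `p` between two paths `σ`, `τ` issuing from `p`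
(each parametrized so that `σ 0 = τ 0 = p`): the limit as `ε → 0⁺` (i.e. the infimum over
`ε > 0`) of the supremum over `0 < s, t < ε` of the Euclidean comparison angles. -/
def upperAngleWrt (d : Z → Z → ℝ) (p : Z) (σ τ : ℝ → Z) : ℝ :=
  sInf {a | ∃ ε > 0, a = sSup {b | ∃ s t : ℝ, 0 < s ∧ s < ε ∧ 0 < t ∧ t < ε ∧
      b = euclCompAngle (d p (σ s)) (d p (τ t)) (d (σ s) (τ t))}}

/-- The CAT(κ) condition (for `κ ≤ 0`), in the angle-comparison form
(Bridson–Haefliger II.1.7(4)): `S` is geodesic and for every triple of distinct points the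
Alexandrov angle between geodesics is at most the comparison angle in `M_κ²`. -/
def IsCATWrt (κ : ℝ) (d : Z → Z → ℝ) (S : Set Z) : Prop :=
  GeodesicSpaceWrt d S ∧
    ∀ p ∈ S, ∀ q ∈ S, ∀ r ∈ S, p ≠ q → p ≠ r → q ≠ r →
      ∀ σ τ : ℝ → Z, IsGeodesicFromTo d S σ p q → IsGeodesicFromTo d S τ p r →
        upperAngleWrt d p σ τ ≤ compAngle κ (d p q) (d p r) (d q r)

/-- Completeness of `S` with respect to the distance function `d`:
every Cauchy sequence converges. -/
def CompleteWrt (d : Z → Z → ℝ) (S : Set Z) : Prop :=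
  ∀ u : ℕ → Z, (∀ n, u n ∈ S) →
    (∀ ε > 0, ∃ N, ∀ m ≥ N, ∀ n ≥ N, d (u m) (u n) < ε) →
    ∃ x ∈ S, ∀ ε > 0, ∃ N, ∀ n ≥ N, d (u n) x < ε

variable {X : Type*} [MetricSpace X]

/-- `X` is a CAT(κ) metric space. -/
def IsCATSpace (κ : ℝ) (X : Type*) [MetricSpace X] : Prop :=
  IsCATWrt κ (fun x y : X => dist x y) univ

/-- The distance function of the metric space `X`. -/
abbrev xDist (X : Type*) [MetricSpace X] : X → X → ℝ := fun x y => dist x y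

/-! ### The model plane `M_κ²` and polyhedral 2-complexes -/

/-- The distance function of the model plane `M_κ²` of constant curvature `κ ≤ 0`, in global
coordinates `ℝ²`: the Euclidean distance for `κ = 0`, and for `κ < 0` the distance of the
hyperboloid model rescaled by `1/√(-κ)` (so that the curvature is `κ`). -/
def mDist (κ : ℝ) (u v : ℝ × ℝ) : ℝ :=
  if κ = 0 then Real.sqrt ((u.1 - v.1) ^ 2 + (u.2 - v.2) ^ 2)
  else
    (1 / Real.sqrt (-κ)) *
      arcosh (Real.sqrt (1 + u.1 ^ 2 + u.2 ^ 2) * Real.sqrt (1 + v.1 ^ 2 + v.2 ^ 2) -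
        u.1 * v.1 - u.2 * v.2)

/-- A convex polygonal 2-cell in `M_κ²`: the geodesically convex hull of a finite set of
points, with nonempty interior. -/
def IsPolygonalCell (κ : ℝ) (P : Set (ℝ × ℝ)) : Prop :=
  ∃ F : Finset (ℝ × ℝ), P = convexHullWrt (mDist κ) (F : Set (ℝ × ℝ)) ∧ (interior P).Nonempty

/-- The subset `S` of `X` embeds isometrically into the model plane `M_κ²`. -/
def IsomEmbedsInModelPlane (κ : ℝ) (S : Set X) : Prop :=
  ∃ f : X → ℝ × ℝ, ∀ x ∈ S, ∀ y ∈ S, mDist κ (f x) (f y) = dist x y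

/-- A locally finite `M_κ`-polyhedral 2-complex structure on the metric space `X`:
`X` is partitioned into open 2-cells (faces), open 1-cells (edges) and vertices; the closure of
each face is isometric to a compact convex polygon of the model plane `M_κ²` (so each face has
constant curvature `κ`), each edge is a geodesic arc, and the complex is locally finite. -/
structure PolyComplex2 (κ : ℝ) (X : Type*) [MetricSpace X] where
  faces : Set (Set X)
  edges : Set (Set X)
  vertices : Set X
  faces_open : ∀ F ∈ faces, IsOpen F
  cover : ⋃₀ faces ∪ ⋃₀ edges ∪ vertices = univ
  cells_disjoint : ∀ c ∈ faces ∪ edges, ∀ c' ∈ faces ∪ edges, c ≠ c' → c ∩ c' = ∅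
  cells_vertex_disjoint : ∀ c ∈ faces ∪ edges, c ∩ vertices = ∅
  face_chart : ∀ F ∈ faces, ∃ (f : X → ℝ × ℝ) (P : Set (ℝ × ℝ)),
    IsPolygonalCell κ P ∧ InjOn f (closure F) ∧ f '' closure F = P ∧ f '' F = interior P ∧
    ∀ x ∈ closure F, ∀ y ∈ closure F, mDist κ (f x) (f y) = dist x y
  edge_geodesic : ∀ e ∈ edges, ∃ (f : ℝ → X) (L : ℝ), 0 < L ∧
    IsGeodesicWrt (fun x y : X => dist x y) f 0 L ∧ f '' Ioo 0 L = e
  edge_closure : ∀ e ∈ edges, closure e \ e ⊆ vertices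
  face_closure : ∀ F ∈ faces, closure F \ F ⊆ ⋃₀ edges ∪ vertices
  locally_finite : ∀ x : X, ∃ ε > 0,
    {c | (c ∈ faces ∨ c ∈ edges) ∧ (c ∩ ball x ε).Nonempty}.Finite ∧
    (vertices ∩ ball x ε).Finite

/-! ### Simple closed curves, their interiors, and first homology -/

/-- A simple closed curve in `X` (identified with its image). -/
structure SCC (X : Type*) [TopologicalSpace X] where
  toFun : ℝ → X
  contOn : ContinuousOn toFun (Icc 0 1)
  loop : toFun 0 = toFun 1
  inj : InjOn toFun (Ico 0 1)

/-- The image of a simple closed curve. -/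
def SCC.img {X : Type*} [TopologicalSpace X] (γ : SCC X) : Set X := γ.toFun '' Icc 0 1

/-- The first singular homology class of a loop, via the Hurewicz isomorphism: the class of
the loop in the abelianization of the fundamental group (of its path component); the loop is
nullhomologous iff this class is trivial. -/
def loopClassH1 {B : Type*} [TopologicalSpace B] {x : B} (p : Path x x) :
    Abelianization (FundamentalGroup B x) :=
  Abelianization.of (FundamentalGroup.fromPath (X := TopCat.of B) ⟦p⟧)

/-- The basepoint of a simple closed curve, regarded in a subspace `B` containing it. -/
def SCC.basePoint {X : Type*} [TopologicalSpace X] (γ : SCC X) (B : Set X)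
    (h : γ.img ⊆ B) : B :=
  ⟨γ.toFun 0, h ⟨0, ⟨le_rfl, zero_le_one⟩, rfl⟩⟩

/-- The loop of a simple closed curve, as a `Path` in a subspace `B` containing it. -/
def SCC.pathIn {X : Type*} [TopologicalSpace X] (γ : SCC X) (B : Set X) (h : γ.img ⊆ B) :
    Path (γ.basePoint B h) (γ.basePoint B h) where
  toFun t := ⟨γ.toFun t, h ⟨(t : ℝ), t.2, rfl⟩⟩
  continuous_toFun := by
    apply Continuous.subtype_mk
    exact γ.contOn.comp_continuous continuous_subtype_val fun t => t.2
  source' := by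
    apply Subtype.ext
    rfl
  target' := by
    apply Subtype.ext
    exact γ.loop.symm

/-- The simple closed curve `γ` is nullhomologous in the subspace `B` of `X`:
its class in `H₁(B)` vanishes. -/
def SCC.NullhomologousIn {X : Type*} [TopologicalSpace X] (γ : SCC X) (B : Set X) : Prop :=
  ∀ h : γ.img ⊆ B, loopClassH1 (γ.pathIn B h) = 1

/-- The interior of a simple closed curve `γ`:
`Int γ = {x ∈ X \ γ | [γ] ≠ 0 ∈ H₁(X \ {x})}`. -/
def SCC.interiorSet {X : Type*} [TopologicalSpace X] (γ : SCC X) : Set X :=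
  {x | x ∉ γ.img ∧ ¬ γ.NullhomologousIn {x}ᶜ}

/-- The first singular homology of `B` vanishes: every loop in `B` is nullhomologous
(via the Hurewicz isomorphism on each path component). -/
def H1Trivial (B : Type*) [TopologicalSpace B] : Prop :=
  ∀ (x : B) (p : Path x x), loopClassH1 p = 1

/-! ### Rectifiable connectedness and the induced path metric -/

/-- `g` is a path from `x` to `y` (parametrized by `[0,1]`) inside `E`. -/
def IsPathIn {X : Type*} [TopologicalSpace X] (E : Set X) (g : ℝ → X) (x y : X) : Prop :=
  ContinuousOn g (Icc 0 1) ∧ g 0 = x ∧ g 1 = y ∧ MapsTo g (Icc 0 1) E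

/-- `E` is rectifiably connected: any two of its points are joined by a rectifiable
(finite length) path in `E`. -/
def RectConnected {X : Type*} [MetricSpace X] (E : Set X) : Prop :=
  ∀ x ∈ E, ∀ y ∈ E, ∃ g : ℝ → X, IsPathIn E g x y ∧ eVariationOn g (Icc 0 1) ≠ ⊤

/-- The induced path metric on `E`: the infimum of the lengths of rectifiable paths in `E`
joining the two points. -/
def pathDistIn {X : Type*} [MetricSpace X] (E : Set X) (x y : X) : ℝ :=
  (⨅ g : {g : ℝ → X // IsPathIn E g x y}, eVariationOn g.1 (Icc 0 1)).toReal


universe u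
/-! ### Conical neighborhoods -/


/-- The distance function of the `κ`-cone (κ ≤ 0) over a space with distance function `dL`:
a point is a pair (radius, link point), all points of radius `0` being identified (the cone
point); the distance is given by the law of cosines in curvature `κ`, with angle
`min π (dL ℓ ℓ')`. -/
def coneDist (κ : ℝ) {L : Type*} (dL : L → L → ℝ) (a b : ℝ × L) : ℝ :=
  if κ = 0 then
    Real.sqrt (a.1 ^ 2 + b.1 ^ 2 - 2 * a.1 * b.1 * Real.cos (min Real.pi (dL a.2 b.2)))
  else
    (1 / Real.sqrt (-κ)) *
      arcosh (Real.cosh (Real.sqrt (-κ) * a.1) * Real.cosh (Real.sqrt (-κ) * b.1) -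
        Real.sinh (Real.sqrt (-κ) * a.1) * Real.sinh (Real.sqrt (-κ) * b.1) *
          Real.cos (min Real.pi (dL a.2 b.2)))

/-- `V` is a conical neighborhood of `p` in `X`: an open neighborhood of `p` isometric to a
convex open subset of the `κ`-cone over a metric space (the link of `p`), the isometry taking
`p` to the cone point. -/
def IsConicalNbhd (κ : ℝ) (p : X) (V : Set X) : Prop :=
  IsOpen V ∧ p ∈ V ∧
    ∃ (L : Type u) (dL : L → L → ℝ) (f : X → ℝ × L),
      (∀ a, dL a a = 0) ∧ (∀ a b, 0 ≤ dL a b) ∧ (∀ a b, dL a b = dL b a) ∧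
      (∀ a b c, dL a c ≤ dL a b + dL b c) ∧
      (∀ x ∈ V, 0 ≤ (f x).1) ∧ (f p).1 = 0 ∧
      (∀ x ∈ V, ∀ y ∈ V, dist x y = coneDist κ dL (f x) (f y)) ∧
      (∀ x ∈ V, (f x).1 = 0 → x = p) ∧
      ConvexWrtIn (coneDist κ dL) {w : ℝ × L | 0 ≤ w.1} (f '' V) ∧
      (∀ z ∈ f '' V, ∃ ε > 0, ∀ w : ℝ × L, 0 ≤ w.1 → coneDist κ dL z w < ε → w ∈ f '' V)

/-! ### Geodesics, triangles, and limit segments in `Y = (E, induced path metric)` -/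

/-- The set `α` is (the image of) a geodesic arc of `Y = (E, pathDistIn E)`. -/
def IsYGeodesicArc (E : Set X) (α : Set X) : Prop :=
  ∃ (f : ℝ → X) (a b : ℝ), IsGeodesicWrt (pathDistIn E) f a b ∧
    MapsTo f (Icc a b) E ∧ f '' Icc a b = α

/-- `T` is a geodesic triangle of `Y = (E, pathDistIn E)` with vertices `p`, `q`, `r`:
the union of the three `Y`-geodesics joining the vertices. -/
def IsYTriangle (E : Set X) (T : Set X) (p q r : X) : Prop :=
  p ∈ E ∧ q ∈ E ∧ r ∈ E ∧
    T = geodSeg (pathDistIn E) E p q ∪ geodSeg (pathDistIn E) E q r ∪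
        geodSeg (pathDistIn E) E r p

/-- The set `γim` (a curve in `E`) is locally geodesic in `Y` at `p`: some subarc of `γim`
containing `p` in its relative interior is a geodesic of `Y`. -/
def LocallyYGeodesicAt (E γim : Set X) (p : X) : Prop :=
  ∃ (f : ℝ → X) (a b t : ℝ), t ∈ Ioo a b ∧ f t = p ∧
    IsGeodesicWrt (pathDistIn E) f a b ∧ MapsTo f (Icc a b) E ∧ f '' Icc a b ⊆ γim

/-- `f : [0,1] → E` is the constant-speed parametrization of the `Y`-geodesic
from `x` to `y`. -/
def IsConstSpeedYGeodesic (E : Set X) (f : ℝ → X) (x y : X) : Prop :=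
  f 0 = x ∧ f 1 = y ∧ MapsTo f (Icc 0 1) E ∧
    ∀ s ∈ Icc (0:ℝ) 1, ∀ t ∈ Icc (0:ℝ) 1,
      pathDistIn E (f s) (f t) = pathDistIn E x y * |s - t|

/-- `R` is the limit segment of length `ε` at `p` of the `Y`-geodesic side from `p` to `q`:
`R` is an `X`-geodesic of length `ε` issuing from `p`, and the `X`-geodesics of length `ε`
from `p` through `σ t` (σ the `Y`-geodesic from `p` to `q`) converge uniformly to `R`
as `t → 0⁺`. -/
def IsLimitSegment (E : Set X) (p q : X) (ε : ℝ) (R : ℝ → X) : Prop :=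
  0 < ε ∧ R 0 = p ∧ IsGeodesicWrt (fun x y : X => dist x y) R 0 ε ∧
    ∀ σ : ℝ → X, IsGeodesicFromTo (pathDistIn E) E σ p q →
      ∀ δ > 0, ∃ t₀ > 0, ∀ t, 0 < t → t ≤ t₀ → t ≤ pathDistIn E p q →
        ∀ g : ℝ → X, IsGeodesicWrt (fun x y : X => dist x y) g 0 ε → g 0 = p →
          g (dist p (σ t)) = σ t → ∀ s ∈ Icc 0 ε, dist (g s) (R s) ≤ δ


end Cat2Cx

end

namespace Cat2Cx

/-! ### Metric spaces satisfying Stewart's inequality -/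

section Stewart

variable {Z : Type*} [MetricSpace Z]

/-- `m` divides the pair `a`, `b` in the ratio `t : 1 - t`, in the sense of the CAT(0) form of
Stewart's theorem. -/
def IsStewartPoint (a b : Z) (t : ℝ) (m : Z) : Prop :=
  ∀ z, dist z m ^ 2 ≤ (1 - t) * dist z a ^ 2 + t * dist z b ^ 2 - t * (1 - t) * dist a b ^ 2

/-- Every pair of points has a dividing point in each ratio. -/
def HasStewartPoints (Z : Type*) [MetricSpace Z] : Prop :=
  ∀ a b : Z, ∀ t ∈ Icc (0 : ℝ) 1, ∃ m, IsStewartPoint a b t m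

/-- `C` contains all dividing points of pairs of its points. -/
def StewartConvex (C : Set Z) : Prop :=
  ∀ a ∈ C, ∀ b ∈ C, ∀ t ∈ Icc (0 : ℝ) 1, ∀ m, IsStewartPoint a b t m → m ∈ C

lemma IsStewartPoint.symm {a b m : Z} {t : ℝ} (h : IsStewartPoint a b t m) :
    IsStewartPoint b a (1 - t) m := by
  intro z
  have := h z
  rw [dist_comm b a]
  nlinarith [this]

lemma IsStewartPoint.dist_left_le {a b m : Z} {t : ℝ} (h : IsStewartPoint a b t m)
    (ht : t ∈ Icc (0 : ℝ) 1) : dist a m ≤ t * dist a b := by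
  have h1 := h a
  rw [dist_self] at h1
  have : dist a m ^ 2 ≤ (t * dist a b) ^ 2 := by nlinarith
  exact (abs_le_of_sq_le_sq' this (mul_nonneg ht.1 dist_nonneg)).2

lemma IsStewartPoint.dist_right_le {a b m : Z} {t : ℝ} (h : IsStewartPoint a b t m)
    (ht : t ∈ Icc (0 : ℝ) 1) : dist b m ≤ (1 - t) * dist a b := by
  have := h.symm.dist_left_le ⟨by linarith [ht.2], by linarith [ht.1]⟩
  rwa [dist_comm b a] at this

lemma IsStewartPoint.dist_le_mul {a b c p q : Z} {t : ℝ} (ht : t ∈ Icc (0 : ℝ) 1)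
    (hp : IsStewartPoint a b t p) (hq : IsStewartPoint a c t q) :
    dist p q ≤ t * dist b c := by
  have h1 := hq p
  have h2 := hp c
  have h3 := hp.dist_left_le ht
  have h4 : dist p a ^ 2 ≤ (t * dist a b) ^ 2 := by
    rw [dist_comm p a]
    exact pow_le_pow_left₀ dist_nonneg h3 2
  have ht1 : 0 ≤ 1 - t := by linarith [ht.2]
  have ht0 : 0 ≤ t := ht.1
  rw [dist_comm c p, dist_comm c a, dist_comm c b] at h2
  have : dist p q ^ 2 ≤ (t * dist b c) ^ 2 := by
    nlinarith [mul_le_mul_of_nonneg_left h4 ht1, mul_le_mul_of_nonneg_left h2 ht0]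
  exact (abs_le_of_sq_le_sq' this (mul_nonneg ht.1 dist_nonneg)).2

lemma StewartConvex.infDist_le (hZ : HasStewartPoints Z) {C : Set Z} (hC : StewartConvex C)
    (hne : C.Nonempty) (r : ℝ) : StewartConvex {z | infDist z C ≤ r} := by
  intro a ha b hb t ht m hm
  change infDist m C ≤ r
  refine le_of_forall_pos_le_add fun ε hε => ?_
  obtain ⟨a', ha', haa⟩ := (infDist_lt_iff hne).1 (lt_of_le_of_lt ha (lt_add_of_pos_right r hε))
  obtain ⟨b', hb', hbb⟩ := (infDist_lt_iff hne).1 (lt_of_le_of_lt hb (lt_add_of_pos_right r hε))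
  obtain ⟨p, hp⟩ := hZ a b' t ht
  obtain ⟨q, hq⟩ := hZ a' b' t ht
  have ht' : 1 - t ∈ Icc (0 : ℝ) 1 := ⟨by linarith [ht.2], by linarith [ht.1]⟩
  have h1 := hm.dist_le_mul ht hp
  have h2 := hp.symm.dist_le_mul ht' hq.symm
  have h3 : infDist m C ≤ dist m q := infDist_le_dist_of_mem (hC a' ha' b' hb' t ht q hq)
  have h4 := dist_triangle m p q
  have h5 : t * dist b b' + (1 - t) * dist a a' < r + ε := by
    rcases ht.1.eq_or_lt with h | h
    · rw [← h]; linarith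
    · nlinarith [mul_lt_mul_of_pos_left hbb h, mul_le_mul_of_nonneg_left haa.le ht'.1]
  linarith

/-- Nearest point property. -/
def IsNearest (C : Set Z) (z p : Z) : Prop := p ∈ C ∧ ∀ c ∈ C, dist z p ≤ dist z c

lemma exists_isNearest [CompleteSpace Z] (hZ : HasStewartPoints Z) {C : Set Z}
    (hC : StewartConvex C) (hne : C.Nonempty) (hcl : IsClosed C) (z : Z) :
    ∃ p, IsNearest C z p := by
  set D := infDist z C with hD
  have hD0 : 0 ≤ D := infDist_nonneg
  have hex : ∀ n : ℕ, ∃ c ∈ C, dist z c < D + 1 / ((n : ℝ) + 1) := fun n =>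
    (infDist_lt_iff hne).1 (lt_add_of_pos_right _ (by positivity))
  choose c hc hcd using hex
  have key : ∀ n m : ℕ, n ≤ m → dist (c n) (c m) ^ 2 ≤ (8 * D + 4) * (1 / ((n : ℝ) + 1)) := by
    intro n m hnm
    obtain ⟨q, hq⟩ := hZ (c n) (c m) (1 / 2) ⟨by norm_num, by norm_num⟩
    have hqC := hC _ (hc n) _ (hc m) _ ⟨by norm_num, by norm_num⟩ q hq
    have h1 : D ≤ dist z q := infDist_le_dist_of_mem hqC
    have h2 := hq z
    have hpos : 0 < 1 / ((n : ℝ) + 1) := by positivity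
    have hle1 : 1 / ((n : ℝ) + 1) ≤ 1 := by
      rw [div_le_one (by positivity)]
      have : (0 : ℝ) ≤ n := Nat.cast_nonneg n
      linarith
    have h3 : dist z (c m) < D + 1 / ((n : ℝ) + 1) := by
      refine (hcd m).trans_le ?_
      gcongr
    have h4 := hcd n
    set e := 1 / ((n : ℝ) + 1)
    have h5 : dist z (c n) ^ 2 ≤ (D + e) ^ 2 := pow_le_pow_left₀ dist_nonneg h4.le 2
    have h6 : dist z (c m) ^ 2 ≤ (D + e) ^ 2 := pow_le_pow_left₀ dist_nonneg h3.le 2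
    have h7 : D ^ 2 ≤ dist z q ^ 2 := pow_le_pow_left₀ hD0 h1 2
    nlinarith
  have hcau : CauchySeq c := by
    rw [Metric.cauchySeq_iff']
    intro ε hε
    obtain ⟨n, hn⟩ := exists_nat_gt ((8 * D + 4) / ε ^ 2)
    refine ⟨n, fun m hm => ?_⟩
    have h1 := key n m hm
    have h2 : (8 * D + 4) * (1 / ((n : ℝ) + 1)) < ε ^ 2 := by
      rw [div_lt_iff₀ (by positivity)] at hn
      rw [mul_one_div, div_lt_iff₀ (by positivity)]
      nlinarith [sq_nonneg ε]
    rw [dist_comm]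
    exact lt_of_pow_lt_pow_left₀ 2 hε.le (h1.trans_lt h2)
  obtain ⟨p, hp⟩ := cauchySeq_tendsto_of_complete hcau
  refine ⟨p, hcl.mem_of_tendsto hp (Eventually.of_forall hc), fun y hy => ?_⟩
  have h1 : dist z p ≤ D := by
    have ht1 : Tendsto (fun n => dist z (c n)) atTop (nhds (dist z p)) :=
      tendsto_const_nhds.dist hp
    have ht2 : Tendsto (fun n : ℕ => D + 1 / ((n : ℝ) + 1)) atTop (nhds (D + 0)) :=
      tendsto_const_nhds.add tendsto_one_div_add_atTop_nhds_zero_nat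
    rw [add_zero] at ht2
    exact le_of_tendsto_of_tendsto' ht1 ht2 fun n => (hcd n).le
  exact h1.trans (infDist_le_dist_of_mem hy)

lemma IsNearest.sq_add_sq_le (hZ : HasStewartPoints Z) {C : Set Z} (hC : StewartConvex C)
    {z p c : Z} (hp : IsNearest C z p) (hc : c ∈ C) :
    dist z p ^ 2 + dist p c ^ 2 ≤ dist z c ^ 2 := by
  have key : ∀ t : ℝ, t ∈ Ioo (0 : ℝ) 1 →
      dist z p ^ 2 + (1 - t) * dist p c ^ 2 ≤ dist z c ^ 2 := by
    intro t ht
    have ht' : t ∈ Icc (0 : ℝ) 1 := Ioo_subset_Icc_self ht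
    obtain ⟨q, hq⟩ := hZ p c t ht'
    have h1 := hp.2 q (hC p hp.1 c hc t ht' q hq)
    have h2 := hq z
    have h3 : dist z p ^ 2 ≤ dist z q ^ 2 := pow_le_pow_left₀ dist_nonneg h1 2
    have h4 : t * (dist z p ^ 2 + (1 - t) * dist p c ^ 2) ≤ t * dist z c ^ 2 := by nlinarith
    exact le_of_mul_le_mul_left h4 ht.1
  have ht1 : Tendsto (fun t : ℝ => dist z p ^ 2 + (1 - t) * dist p c ^ 2) (nhdsWithin 0 (Ioi 0))
      (nhds (dist z p ^ 2 + (1 - 0) * dist p c ^ 2)) := by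
    apply Tendsto.mono_left _ nhdsWithin_le_nhds
    apply Continuous.tendsto
    fun_prop
  have := le_of_tendsto ht1 (by
    filter_upwards [Ioo_mem_nhdsGT (show (0 : ℝ) < 1 by norm_num)] with t ht using key t ht)
  linarith

lemma IsNearest.eq_of_mem {C : Set Z} {z p : Z} (hp : IsNearest C z p) (hz : z ∈ C) : p = z := by
  have := hp.2 z hz
  rw [dist_self] at this
  exact (dist_le_zero.1 this).symm

/-- The quadrilateral inequality with a weight. -/
lemma quadrilateral_weighted (hZ : HasStewartPoints Z) (x₁ x₂ x₃ x₄ : Z) {t : ℝ}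
    (ht : t ∈ Ioo (0 : ℝ) 1) :
    dist x₁ x₃ ^ 2 + dist x₂ x₄ ^ 2 ≤ dist x₁ x₂ ^ 2 + dist x₃ x₄ ^ 2 +
      t / (1 - t) * dist x₂ x₃ ^ 2 + (1 - t) / t * dist x₄ x₁ ^ 2 := by
  obtain ⟨m, hm⟩ := hZ x₁ x₃ t (Ioo_subset_Icc_self ht)
  have h2 := hm x₂
  have h4 := hm x₄
  have h0 := ht.1
  have h1 : 0 < 1 - t := by linarith [ht.2]
  have h5 : dist x₂ x₄ ≤ dist x₂ m + dist x₄ m := dist_triangle_right _ _ _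
  have h6 : dist x₂ x₄ ^ 2 ≤ (dist x₂ m + dist x₄ m) ^ 2 := pow_le_pow_left₀ dist_nonneg h5 2
  have h7 : t * (1 - t) * (dist x₂ m + dist x₄ m) ^ 2 ≤
      t * dist x₂ m ^ 2 + (1 - t) * dist x₄ m ^ 2 := by
    nlinarith [sq_nonneg (t * dist x₂ m - (1 - t) * dist x₄ m)]
  rw [dist_comm x₂ x₁] at h2
  rw [dist_comm x₄ x₃] at h4
  have h8 : t * (1 - t) * dist x₂ x₄ ^ 2 ≤
      t * ((1 - t) * dist x₁ x₂ ^ 2 + t * dist x₂ x₃ ^ 2 - t * (1 - t) * dist x₁ x₃ ^ 2) +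
      (1 - t) * ((1 - t) * dist x₄ x₁ ^ 2 + t * dist x₃ x₄ ^ 2 -
        t * (1 - t) * dist x₁ x₃ ^ 2) := by
    have := mul_le_mul_of_nonneg_left h6 (mul_pos h0 h1).le
    have := mul_le_mul_of_nonneg_left h2 h0.le
    have := mul_le_mul_of_nonneg_left h4 h1.le
    linarith
  have h9 : t * (1 - t) * (dist x₁ x₃ ^ 2 + dist x₂ x₄ ^ 2) ≤
      t * (1 - t) * (dist x₁ x₂ ^ 2 + dist x₃ x₄ ^ 2 +
      t / (1 - t) * dist x₂ x₃ ^ 2 + (1 - t) / t * dist x₄ x₁ ^ 2) := by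
    have e1 : t * (1 - t) * (t / (1 - t) * dist x₂ x₃ ^ 2) = t * (t * dist x₂ x₃ ^ 2) := by
      field_simp
    have e2 : t * (1 - t) * ((1 - t) / t * dist x₄ x₁ ^ 2) =
        (1 - t) * ((1 - t) * dist x₄ x₁ ^ 2) := by
      field_simp
    nlinarith
  exact le_of_mul_le_mul_left h9 (mul_pos h0 h1)

lemma quadrilateral_le (hZ : HasStewartPoints Z) (x₁ x₂ x₃ x₄ : Z) :
    dist x₁ x₃ ^ 2 + dist x₂ x₄ ^ 2 ≤ dist x₁ x₂ ^ 2 + dist x₃ x₄ ^ 2 +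
      2 * dist x₂ x₃ * dist x₄ x₁ := by
  have key : ∀ ε : ℝ, 0 < ε → dist x₁ x₃ ^ 2 + dist x₂ x₄ ^ 2 ≤
      dist x₁ x₂ ^ 2 + dist x₃ x₄ ^ 2 + 2 * (dist x₂ x₃ + ε) * (dist x₄ x₁ + ε) := by
    intro ε hε
    have hq : 0 < dist x₂ x₃ + ε := by positivity
    have hp : 0 < dist x₄ x₁ + ε := by positivity
    set q := dist x₂ x₃ + ε with hqd
    set p := dist x₄ x₁ + ε with hpd
    have h := quadrilateral_weighted hZ x₁ x₂ x₃ x₄ (t := p / (p + q))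
      ⟨by positivity, by rw [div_lt_one (by positivity)]; linarith⟩
    have e1 : p / (p + q) / (1 - p / (p + q)) = p / q := by
      have : 1 - p / (p + q) = q / (p + q) := by field_simp; ring
      rw [this]; field_simp
    have e2 : (1 - p / (p + q)) / (p / (p + q)) = q / p := by
      have : 1 - p / (p + q) = q / (p + q) := by field_simp; ring
      rw [this]; field_simp
    rw [e1, e2] at h
    have i1 : p / q * dist x₂ x₃ ^ 2 ≤ p / q * q ^ 2 := by
      gcongr; linarith
    have i2 : q / p * dist x₄ x₁ ^ 2 ≤ q / p * p ^ 2 := by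
      gcongr; linarith
    have j1 : p / q * q ^ 2 = q * p := by field_simp
    have j2 : q / p * p ^ 2 = q * p := by field_simp
    linarith
  have ht1 : Tendsto (fun ε : ℝ => dist x₁ x₂ ^ 2 + dist x₃ x₄ ^ 2 +
      2 * (dist x₂ x₃ + ε) * (dist x₄ x₁ + ε)) (nhdsWithin 0 (Ioi 0))
      (nhds (dist x₁ x₂ ^ 2 + dist x₃ x₄ ^ 2 +
      2 * (dist x₂ x₃ + 0) * (dist x₄ x₁ + 0))) := by
    apply Tendsto.mono_left _ nhdsWithin_le_nhds
    apply Continuous.tendsto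
    fun_prop
  have := ge_of_tendsto ht1 (by
    filter_upwards [self_mem_nhdsWithin] with t ht using key t ht)
  simpa using this

/-- Nearest point projection contracts distances, with the change of height subtracted. -/
lemma IsNearest.sq_dist_add_sq_le (hZ : HasStewartPoints Z) {C : Set Z} (hC : StewartConvex C)
    {z w p q : Z} (hp : IsNearest C z p) (hq : IsNearest C w q) :
    dist p q ^ 2 + (dist z p - dist w q) ^ 2 ≤ dist z w ^ 2 := by
  have h1 := hp.sq_add_sq_le hZ hC hq.1
  have h2 := hq.sq_add_sq_le hZ hC hp.1
  have h3 := quadrilateral_le hZ z w q p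
  rw [dist_comm q p, dist_comm p z] at h3
  rw [dist_comm q p] at h2
  nlinarith

lemma IsNearest.dist_le (hZ : HasStewartPoints Z) {C : Set Z} (hC : StewartConvex C)
    {z w p q : Z} (hp : IsNearest C z p) (hq : IsNearest C w q) : dist p q ≤ dist z w := by
  have := hp.sq_dist_add_sq_le hZ hC hq
  exact (abs_le_of_sq_le_sq' (by nlinarith [sq_nonneg (dist z p - dist w q)]) dist_nonneg).2

/-- The projection of an exterior point to a sublevel set of the distance function `infDist · C`
lies on the level set. -/
lemma IsNearest.infDist_eq (hZ : HasStewartPoints Z) {C : Set Z} {r : ℝ} {z p : Z}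
    (hp : IsNearest {z | infDist z C ≤ r} z p) (hz : r < infDist z C) : infDist p C = r := by
  refine le_antisymm hp.1 ?_
  by_contra! hlt
  have hpz : 0 < dist p z := by
    rw [dist_pos]
    rintro rfl
    exact absurd hp.1 (not_le.2 hz)
  set s := min (1 / 2) ((r - infDist p C) / dist p z) with hs
  have hs0 : 0 < s := lt_min (by norm_num) (div_pos (by linarith) hpz)
  have hs1 : s ≤ 1 / 2 := min_le_left _ _
  have hs2 : s * dist p z ≤ r - infDist p C := by
    rw [← le_div_iff₀ hpz]
    exact min_le_right _ _
  have hmem : s ∈ Icc (0 : ℝ) 1 := ⟨hs0.le, by linarith⟩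
  obtain ⟨m, hm⟩ := hZ p z s hmem
  have h1 := hm.dist_left_le hmem
  have h2 := hm.dist_right_le hmem
  have h3 : infDist m C ≤ infDist p C + dist m p := infDist_le_infDist_add_dist
  rw [dist_comm m p] at h3
  have h4 := hp.2 m (show infDist m C ≤ r by linarith)
  rw [dist_comm z p] at h4
  nlinarith

/-- A point at height at most `R` above `C` is close to the sublevel set at height
`(1 - s) * R`. -/
lemma exists_infDist_le_dist_le (hZ : HasStewartPoints Z) {C : Set Z} (hne : C.Nonempty)
    {R s r : ℝ} (hs : s ∈ Ioo (0 : ℝ) 1) (hr : (1 - s) * R < r) {z : Z} (hz : infDist z C ≤ R) :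
    ∃ w, infDist w C ≤ r ∧ dist z w ≤ s * r / (1 - s) := by
  have hs1 : 0 < 1 - s := by linarith [hs.2]
  have hs0 := hs.1
  have h1 : infDist z C < r / (1 - s) := by
    rw [lt_div_iff₀ hs1]
    nlinarith
  obtain ⟨c, hc, hzc⟩ := (infDist_lt_iff hne).1 h1
  obtain ⟨w, hw⟩ := hZ z c s (Ioo_subset_Icc_self hs)
  have h2 := hw.dist_left_le (Ioo_subset_Icc_self hs)
  have h3 := hw.dist_right_le (Ioo_subset_Icc_self hs)
  refine ⟨w, ?_, ?_⟩
  · have h4 : infDist w C ≤ dist w c := infDist_le_dist_of_mem hc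
    rw [lt_div_iff₀ hs1] at hzc
    rw [dist_comm w c] at h4
    nlinarith
  · rw [mul_div_assoc]
    nlinarith

end Stewart

/-! ### Generic level sets -/

section Levels

open MeasureTheory ENNReal

lemma ae_frequently_card_le {Z : Type*} (P : ℕ → Finset Z) (r a : ℕ → ℝ) (ha : ∀ j, 0 < a j)
    (A : ℝ) (hA : ∀ j, (P j).card * r j ≤ A * a j) (φ : Z → ℝ) :
    ∀ᵐ v : ℝ, ∃ D : ℕ, ∃ᶠ j in atTop, (((P j).filter fun c => |φ c - v| ≤ r j).card : ℝ)
      ≤ D * a j := by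
  classical
  set g : ℕ → ℝ → ℝ≥0∞ := fun j v =>
    (∑ c ∈ P j, (Icc (φ c - r j) (φ c + r j)).indicator (fun _ => ENNReal.ofReal (1 / a j)) v)
    with hg
  have hgm : ∀ j, Measurable (g j) := fun j =>
    Finset.measurable_sum _ fun c _ => measurable_const.indicator measurableSet_Icc
  have hint : ∀ j, ∫⁻ v, g j v ≤ ENNReal.ofReal (2 * A) := by
    intro j
    simp only [hg]
    rw [lintegral_finsetSum _ fun c _ => measurable_const.indicator measurableSet_Icc]
    simp only [lintegral_indicator measurableSet_Icc, lintegral_const, Measure.restrict_apply,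
      MeasurableSet.univ, univ_inter, Real.volume_Icc]
    have h1 : ∀ c, φ c + r j - (φ c - r j) = 2 * r j := fun c => by ring
    simp only [h1, Finset.sum_const, nsmul_eq_mul]
    rw [← ENNReal.ofReal_mul (by have := ha j; positivity),
      ← ENNReal.ofReal_natCast, ← ENNReal.ofReal_mul (Nat.cast_nonneg _)]
    apply ENNReal.ofReal_le_ofReal
    have h2 := hA j
    have h3 := ha j
    rw [show ((P j).card : ℝ) * (1 / a j * (2 * r j)) = (2 * ((P j).card * r j)) / a j by ring,
      div_le_iff₀ h3]
    linarith
  have h1 : ∫⁻ v, liminf (fun j => g j v) atTop ≤ ENNReal.ofReal (2 * A) := by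
    refine (lintegral_liminf_le hgm).trans ?_
    refine (liminf_le_liminf (Eventually.of_forall hint)).trans ?_
    simp
  have h2 : ∀ᵐ v : ℝ, liminf (fun j => g j v) atTop < ⊤ :=
    ae_lt_top (.liminf hgm) (h1.trans_lt ofReal_lt_top).ne
  filter_upwards [h2] with v hv
  obtain ⟨D, hD⟩ := ENNReal.exists_nat_gt hv.ne
  refine ⟨D, (frequently_lt_of_liminf_lt (by isBoundedDefault) hD).mono fun j hj => ?_⟩
  have h3 : g j v = ENNReal.ofReal
      ((((P j).filter fun c => |φ c - v| ≤ r j).card : ℝ) * (1 / a j)) := by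
    simp only [hg]
    rw [ENNReal.ofReal_mul (Nat.cast_nonneg _), ENNReal.ofReal_natCast, Finset.card_filter,
      Nat.cast_sum, Finset.sum_mul]
    refine Finset.sum_congr rfl fun c _ => ?_
    have : v ∈ Icc (φ c - r j) (φ c + r j) ↔ |φ c - v| ≤ r j := by
      rw [abs_le, mem_Icc]
      constructor <;> rintro ⟨h1, h2⟩ <;> constructor <;> linarith
    by_cases h : |φ c - v| ≤ r j
    · rw [indicator_of_mem (this.2 h), if_pos h]; simp
    · rw [indicator_of_notMem (fun h' => h (this.1 h')), if_neg h]; simp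
  rw [h3, ← ENNReal.ofReal_natCast, ENNReal.ofReal_lt_ofReal_iff_of_nonneg
    (by have := ha j; positivity), mul_one_div, div_lt_iff₀ (ha j)] at hj
  exact hj.le

variable {Z : Type*} [MetricSpace Z]

/-- `N` is covered by `O(n²)` balls of radius `1/n`. -/
def HasQuadraticCover (N : Set Z) : Prop :=
  ∃ A : ℝ, ∀ n : ℕ, ∃ P : Finset Z, (P.card : ℝ) ≤ A * ((n : ℝ) + 1) ^ 2 ∧
    ∀ z ∈ N, ∃ c ∈ P, dist z c ≤ 1 / ((n : ℝ) + 1)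

lemma finite_of_frequently_cover {T : Set Z} {D : ℕ}
    (h : ∃ᶠ j : ℕ in atTop, ∃ P : Finset Z, P.card ≤ D ∧
      ∀ z ∈ T, ∃ c ∈ P, dist z c ≤ 1 / ((j : ℝ) + 1)) : T.Finite := by
  classical
  by_contra hT
  obtain ⟨F, hFT, hF⟩ := Set.Infinite.exists_subset_card_eq hT (D + 1)
  obtain ⟨δ, hδ, hsep⟩ : ∃ δ > 0, ∀ x ∈ F, ∀ y ∈ F, x ≠ y → δ < dist x y := by
    have hne : (insert (1 : ℝ) (((F ×ˢ F).filter fun p => p.1 ≠ p.2).image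
      fun p => dist p.1 p.2)).Nonempty := ⟨1, by simp⟩
    set m := Finset.min' _ hne with hm
    have hm0 : 0 < m := by
      rw [hm, Finset.lt_min'_iff]
      intro y hy
      simp only [Finset.mem_insert, Finset.mem_image, Finset.mem_filter, Finset.mem_product] at hy
      rcases hy with rfl | ⟨p, ⟨_, hp⟩, rfl⟩
      · norm_num
      · exact dist_pos.2 hp
    refine ⟨m / 2, by linarith, fun x hx y hy hxy => ?_⟩
    have : m ≤ dist x y := Finset.min'_le _ _ (by
      simp only [Finset.mem_insert, Finset.mem_image, Finset.mem_filter, Finset.mem_product]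
      exact Or.inr ⟨(x, y), ⟨⟨hx, hy⟩, hxy⟩, rfl⟩)
    linarith
  have hev : ∀ᶠ j : ℕ in atTop, 1 / ((j : ℝ) + 1) < δ / 2 :=
    tendsto_one_div_add_atTop_nhds_zero_nat.eventually_lt_const (by positivity)
  obtain ⟨j, ⟨P, hPD, hP⟩, hj⟩ := (h.and_eventually hev).exists
  choose! c hcP hc using hP
  obtain ⟨x, hx, y, hy, hxy, hcxy⟩ := Finset.exists_ne_map_eq_of_card_lt_of_maps_to
    (s := F) (t := P) (by omega) (f := c) fun x hx => hcP x (hFT hx)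
  have h1 := hc x (hFT hx)
  have h2 := hc y (hFT hy)
  have h3 := hsep x hx y hy hxy
  have h4 := dist_triangle_right x y (c x)
  rw [hcxy] at h1 h4
  linarith

lemma HasQuadraticCover.ae_finite {N : Set Z} (hN : HasQuadraticCover N) {u : Z → ℝ}
    (hu : LipschitzWith 1 u) :
    ∀ᵐ v : ℝ, ∀ k : Z, ∀ᵐ ρ : ℝ, {z | z ∈ N ∧ u z = v ∧ dist z k = ρ}.Finite := by
  classical
  obtain ⟨A, hA⟩ := hN
  choose P hP hcov using hA
  have h1 := ae_frequently_card_le P (fun j => 1 / ((j : ℝ) + 1)) (fun j => (j : ℝ) + 1)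
    (fun j => by positivity) A (fun j => by
      rw [mul_one_div, div_le_iff₀ (by positivity)]
      have := hP j
      nlinarith) u
  filter_upwards [h1] with v hv k
  obtain ⟨D, hD⟩ := hv
  obtain ⟨ns, hns, hns'⟩ := extraction_of_frequently_atTop hD
  have h2 := ae_frequently_card_le
    (fun i => (P (ns i)).filter fun c => |u c - v| ≤ 1 / ((ns i : ℝ) + 1))
    (fun i => 1 / ((ns i : ℝ) + 1)) (fun _ => 1) (fun _ => one_pos) D (fun i => by
      rw [mul_one_div, div_le_iff₀ (by positivity)]
      have := hns' i
      simpa using this) (fun z => dist z k)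
  filter_upwards [h2] with ρ hρ
  obtain ⟨D', hD'⟩ := hρ
  refine finite_of_frequently_cover (D := D') ?_
  refine hns.tendsto_atTop.frequently (hD'.mono fun i hi => ⟨_, by exact_mod_cast (by simpa using hi), ?_⟩)
  rintro z ⟨hzN, hzu, hzk⟩
  obtain ⟨c, hcP, hc⟩ := hcov (ns i) z hzN
  refine ⟨c, ?_, hc⟩
  rw [dist_comm] at hc
  simp only [Finset.mem_filter]
  refine ⟨⟨hcP, ?_⟩, ?_⟩
  · rw [← hzu, ← Real.dist_eq]
    exact (hu.dist_le_mul c z).trans (by simpa using hc)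
  · rw [← hzk]
    exact (abs_dist_sub_le c z k).trans (by simpa using hc)

end Levels

/-! ### Short paths from chains -/

section Chains

open MeasureTheory

variable {Z : Type*} [MetricSpace Z]

/-- `ChainTo K ε x z l`: there is a chain in `K` from `x` to `z` of steps shorter than `ε` and of
total length `l`. -/
inductive ChainTo (K : Set Z) (ε : ℝ) (x : Z) : Z → ℝ → Prop
  | refl : ChainTo K ε x x 0
  | step {z w : Z} {l : ℝ} : ChainTo K ε x z l → w ∈ K → dist z w < ε →
      ChainTo K ε x w (l + dist z w)

lemma ChainTo.nonneg {K : Set Z} {ε : ℝ} {x z : Z} {l : ℝ} (h : ChainTo K ε x z l) : 0 ≤ l := by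
  induction h with
  | refl => exact le_rfl
  | step _ _ _ ih => exact add_nonneg ih dist_nonneg

lemma ChainTo.exists_coarse_path {K : Set Z} {ε : ℝ} (hε : 0 < ε) {x z : Z} {l : ℝ} (hx : x ∈ K)
    (h : ChainTo K ε x z l) : ∃ c : ℝ → Z, (∀ t, c t ∈ K) ∧ (∀ t < 0, c t = x) ∧
      (∀ t, l ≤ t → c t = z) ∧ ∀ s t, s ≤ t → dist (c s) (c t) ≤ t - s + ε := by
  induction h with
  | refl =>
    exact ⟨fun _ => x, fun _ => hx, fun _ _ => rfl, fun _ _ => rfl, fun s t h => by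
      rw [dist_self]; linarith⟩
  | @step z w l hz hw hzw ih =>
    obtain ⟨c, hcK, hc0, hcl, hc⟩ := ih
    have hl := hz.nonneg
    refine ⟨fun t => if t < l + dist z w then c t else w, fun t => ?_, fun t ht => ?_,
      fun t ht => if_neg (not_lt.2 ht), fun s t hst => ?_⟩
    · dsimp only
      split_ifs
      exacts [hcK t, hw]
    · dsimp only
      rw [if_pos (by linarith [dist_nonneg (x := z) (y := w)]), hc0 t ht]
    · dsimp only
      split_ifs with h1 h2 h2
      · exact hc s t hst
      · rcases le_total l s with hs | hs
        · rw [hcl s hs]; linarith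
        · have h3 := hc s l hs
          rw [hcl l le_rfl] at h3
          have := dist_triangle (c s) z w
          linarith
      · linarith
      · rw [dist_self]; linarith

lemma exists_chainTo_of_not_split {K : Set Z} {g : ℝ → Z} {M : ℝ → ℝ} {L B T ε : ℝ}
    (hL : 0 ≤ L) (hε : 0 < ε)
    (hK : IsCompact K) (hg : ∀ s t, 0 ≤ s → s ≤ t → t ≤ L → dist (g s) (g t) ≤ M t - M s)
    (hM : ∀ s t, 0 ≤ s → s ≤ t → t ≤ L → M t - M s ≤ B * (t - s))
    (hT : M L - M 0 < T) (hKg : K ⊆ g '' Icc 0 L) {x y : Z} (hx : x ∈ K) (hy : y ∈ K)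
    (hsplit : ∀ K₁ K₂ : Set Z, IsCompact K₁ → IsCompact K₂ → Disjoint K₁ K₂ → K₁ ∪ K₂ = K →
      x ∈ K₁ → y ∈ K₂ → False) :
    ∃ l < T, ChainTo K ε x y l := by
  classical
  by_contra! hno
  have hT0 : 0 < T := by
    have := (dist_nonneg).trans (hg 0 L le_rfl hL le_rfl)
    linarith
  set φ : Z → ℝ := fun z => sInf ({l | ChainTo K ε x z l} ∪ {T}) with hφ
  have hbdd : ∀ z, BddBelow ({l | ChainTo K ε x z l} ∪ {T}) := by
    intro z
    refine ⟨0, ?_⟩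
    rintro l (hl | rfl)
    exacts [hl.nonneg, hT0.le]
  have hnonneg : ∀ z, 0 ≤ φ z := fun z => by
    refine le_csInf ⟨T, Or.inr rfl⟩ ?_
    rintro l (hl | rfl)
    exacts [hl.nonneg, hT0.le]
  have hφx : φ x = 0 := le_antisymm (csInf_le (hbdd x) (Or.inl .refl)) (hnonneg x)
  have hφy : T ≤ φ y := by
    refine le_csInf ⟨T, Or.inr rfl⟩ ?_
    rintro l (hl | rfl)
    · by_contra! h
      exact hno l h hl
    · exact le_rfl
  have hlip1 : ∀ z ∈ K, ∀ w ∈ K, dist z w < ε → φ w ≤ φ z + dist z w := by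
    intro z hz w hw hzw
    rw [← sub_le_iff_le_add]
    refine le_csInf ⟨T, Or.inr rfl⟩ ?_
    rintro l (hl | rfl)
    · rw [sub_le_iff_le_add]
      exact csInf_le (hbdd w) (Or.inl (ChainTo.step hl hw hzw))
    · have : φ w ≤ l := csInf_le (hbdd w) (Or.inr rfl)
      linarith [dist_nonneg (x := z) (y := w)]
  have hlip : ∀ z ∈ K, ∀ w ∈ K, dist z w < ε → dist (φ z) (φ w) ≤ dist z w := by
    intro z hz w hw hzw
    rw [Real.dist_eq, abs_le]
    have h1 := hlip1 z hz w hw hzw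
    have h2 := hlip1 w hw z hz (by rwa [dist_comm])
    rw [dist_comm w z] at h2
    constructor <;> linarith
  have hcont : ContinuousOn φ K := by
    rw [Metric.continuousOn_iff]
    intro z hz η hη
    refine ⟨min ε η, lt_min hε hη, fun w hw hwz => ?_⟩
    exact (hlip w hw z hz (hwz.trans_le (min_le_left _ _))).trans_lt
      (hwz.trans_le (min_le_right _ _))
  have hvol : volume (φ '' K) ≤ ENNReal.ofReal (M L - M 0) := by
    obtain ⟨n, hn⟩ := exists_nat_gt (B * L / ε)
    set τ : ℕ → ℝ := fun i => L * (i / ((n : ℝ) + 1)) with hτ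
    have hn1 : (0 : ℝ) < (n : ℝ) + 1 := by positivity
    have hτmono : Monotone τ := by
      intro i j hij
      simp only [hτ]
      gcongr
    have hτ0 : τ 0 = 0 := by simp [hτ]
    have hτn : τ (n + 1) = L := by
      simp only [hτ]; push_cast; field_simp
    have hτstep : ∀ i, τ (i + 1) - τ i = L / ((n : ℝ) + 1) := by
      intro i; simp only [hτ]; push_cast; field_simp; ring
    have hcover : φ '' K ⊆ ⋃ i ∈ Finset.range (n + 1),
        φ '' (K ∩ g '' Icc (τ i) (τ (i + 1))) := by
      rintro _ ⟨z, hz, rfl⟩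
      obtain ⟨t, ht, rfl⟩ := hKg hz
      have hex : ∃ i, t ≤ τ (i + 1) := ⟨n, by rw [hτn]; exact ht.2⟩
      have hle : Nat.find hex ≤ n := Nat.find_min' hex (by rw [hτn]; exact ht.2)
      simp only [mem_iUnion, Finset.mem_range]
      refine ⟨Nat.find hex, by omega, g t, ⟨hz, t, ⟨?_, Nat.find_spec hex⟩, rfl⟩, rfl⟩
      rcases Nat.eq_zero_or_pos (Nat.find hex) with h0 | hpos
      · rw [h0, hτ0]; exact ht.1
      · have := Nat.find_min hex (m := Nat.find hex - 1) (by omega)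
        rw [Nat.sub_add_cancel hpos] at this
        exact (not_le.1 this).le
    have hpiece : ∀ i ∈ Finset.range (n + 1), volume (φ '' (K ∩ g '' Icc (τ i) (τ (i + 1))))
        ≤ ENNReal.ofReal (M (τ (i + 1)) - M (τ i)) := by
      intro i hi
      have hi' : i + 1 ≤ n + 1 := by simpa using hi
      have h0 : 0 ≤ τ i := hτ0 ▸ hτmono (Nat.zero_le i)
      have h1 : τ (i + 1) ≤ L := hτn ▸ hτmono hi'
      have hii : τ i ≤ τ (i + 1) := hτmono (Nat.le_succ i)
      have hmono : ∀ s t, 0 ≤ s → s ≤ t → t ≤ L → M s ≤ M t := fun s t a b c => by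
        linarith [dist_nonneg.trans (hg s t a b c)]
      have hsmall : M (τ (i + 1)) - M (τ i) < ε := by
        have h2 := hM (τ i) (τ (i + 1)) h0 hii h1
        rw [hτstep] at h2
        refine h2.trans_lt ?_
        rw [div_lt_iff₀ hε] at hn
        rw [← mul_div_assoc, div_lt_iff₀ hn1]
        nlinarith
      refine (Real.volume_le_diam _).trans ?_
      refine Metric.ediam_le ?_
      rintro _ ⟨_, ⟨hz, s, hs, rfl⟩, rfl⟩ _ ⟨_, ⟨hw, t, ht, rfl⟩, rfl⟩
      have hd : dist (g s) (g t) ≤ M (τ (i + 1)) - M (τ i) := by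
        rcases le_total s t with hst | hst
        · have := hg s t (h0.trans hs.1) hst (ht.2.trans h1)
          linarith [hmono _ _ h0 hs.1 (hs.2.trans h1),
            hmono _ _ (h0.trans ht.1) ht.2 h1]
        · have := hg t s (h0.trans ht.1) hst (hs.2.trans h1)
          rw [dist_comm]
          linarith [hmono _ _ h0 ht.1 (ht.2.trans h1),
            hmono _ _ (h0.trans hs.1) hs.2 h1]
      rw [edist_dist]
      exact ENNReal.ofReal_le_ofReal ((hlip _ hz _ hw (hd.trans_lt hsmall)).trans hd)
    calc volume (φ '' K) ≤ ∑ i ∈ Finset.range (n + 1),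
          volume (φ '' (K ∩ g '' Icc (τ i) (τ (i + 1)))) :=
          (measure_mono hcover).trans (measure_biUnion_finset_le _ _)
      _ ≤ ∑ i ∈ Finset.range (n + 1), ENNReal.ofReal (M (τ (i + 1)) - M (τ i)) :=
          Finset.sum_le_sum hpiece
      _ = ENNReal.ofReal (M L - M 0) := by
          rw [← ENNReal.ofReal_sum_of_nonneg, Finset.sum_range_sub (fun i => M (τ i)), hτ0, hτn]
          intro i hi
          have hi' : i + 1 ≤ n + 1 := by simpa using hi
          exact dist_nonneg.trans (hg (τ i) (τ (i + 1)) (hτ0 ▸ hτmono (Nat.zero_le i))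
            (hτmono (Nat.le_succ i)) (hτn ▸ hτmono hi'))
  obtain ⟨v, hv, hvφ⟩ : ∃ v ∈ Ioo 0 T, v ∉ φ '' K := by
    by_contra! h
    have h1 : volume (Ioo 0 T) ≤ volume (φ '' K) := measure_mono h
    rw [Real.volume_Ioo, sub_zero] at h1
    have h2 := h1.trans hvol
    rw [ENNReal.ofReal_le_ofReal_iff' ] at h2
    rcases h2 with h2 | h2 <;> linarith
  refine hsplit (K ∩ φ ⁻¹' Iic v) (K ∩ φ ⁻¹' Ici v)
    (hK.of_isClosed_subset (hcont.preimage_isClosed_of_isClosed hK.isClosed isClosed_Iic)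
      inter_subset_left)
    (hK.of_isClosed_subset (hcont.preimage_isClosed_of_isClosed hK.isClosed isClosed_Ici)
      inter_subset_left) ?_ ?_ ⟨hx, ?_⟩ ⟨hy, ?_⟩
  · rw [Set.disjoint_left]
    rintro z ⟨hz, h1⟩ ⟨_, h2⟩
    exact hvφ ⟨z, hz, le_antisymm h1 h2⟩
  · rw [← inter_union_distrib_left, ← preimage_union, Iic_union_Ici, preimage_univ, inter_univ]
  · change φ x ≤ v
    rw [hφx]; exact hv.1.le
  · exact hv.2.le.trans hφy

lemma exists_lipschitz_path_of_not_split {K : Set Z} {g : ℝ → Z} {M : ℝ → ℝ} {L B T : ℝ}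
    (hL : 0 ≤ L)
    (hK : IsCompact K) (hg : ∀ s t, 0 ≤ s → s ≤ t → t ≤ L → dist (g s) (g t) ≤ M t - M s)
    (hM : ∀ s t, 0 ≤ s → s ≤ t → t ≤ L → M t - M s ≤ B * (t - s))
    (hT : M L - M 0 < T) (hKg : K ⊆ g '' Icc 0 L) {x y : Z} (hx : x ∈ K) (hy : y ∈ K)
    (hsplit : ∀ K₁ K₂ : Set Z, IsCompact K₁ → IsCompact K₂ → Disjoint K₁ K₂ → K₁ ∪ K₂ = K →
      x ∈ K₁ → y ∈ K₂ → False) :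
    ∃ c : ℝ → Z, LipschitzWith 1 c ∧ (∀ t, c t ∈ K) ∧ c 0 = x ∧ c T = y := by
  have hex : ∀ n : ℕ, ∃ c : ℝ → Z, (∀ t, c t ∈ K) ∧ (∀ t < 0, c t = x) ∧
      (∀ t, T ≤ t → c t = y) ∧ ∀ s t, s ≤ t → dist (c s) (c t) ≤ t - s + 1 / ((n : ℝ) + 1) := by
    intro n
    have hε : 0 < 1 / ((n : ℝ) + 1) := by positivity
    obtain ⟨l, hl, hc⟩ := exists_chainTo_of_not_split hL hε hK hg hM hT hKg hx hy hsplit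
    obtain ⟨c, h1, h2, h3, h4⟩ := hc.exists_coarse_path hε hx
    exact ⟨c, h1, h2, fun t ht => h3 t (hl.le.trans ht), h4⟩
  choose c hcK hc0 hcT hc using hex
  have hlim : ∀ t, ∃ p ∈ K, Tendsto (fun n => c n t) (hyperfilter ℕ) (nhds p) := by
    intro t
    obtain ⟨p, hp, hle⟩ := hK.ultrafilter_le_nhds ((hyperfilter ℕ).map fun n => c n t) (by
      rw [Ultrafilter.coe_map, le_principal_iff, mem_map]
      exact Eventually.of_forall fun n => hcK n t)
    exact ⟨p, hp, hle⟩
  choose p hpK hp using hlim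
  have hle : ∀ s t, s ≤ t → dist (p s) (p t) ≤ t - s := by
    intro s t hst
    have h1 : Tendsto (fun n : ℕ => t - s + 1 / ((n : ℝ) + 1)) (hyperfilter ℕ)
        (nhds (t - s + 0)) :=
      (tendsto_const_nhds.add tendsto_one_div_add_atTop_nhds_zero_nat).mono_left
        (Nat.hyperfilter_le_atTop)
    rw [add_zero] at h1
    exact le_of_tendsto_of_tendsto' ((hp s).dist (hp t)) h1 fun n => hc n s t hst
  have hlip : LipschitzWith 1 p := LipschitzWith.of_dist_le_mul fun s t => by
    rw [NNReal.coe_one, one_mul, Real.dist_eq]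
    rcases le_total s t with h | h
    · rw [abs_sub_comm, abs_of_nonneg (by linarith)]; exact hle s t h
    · rw [abs_of_nonneg (by linarith), dist_comm]; exact hle t s h
  have hneg : ∀ t < 0, p t = x := fun t ht =>
    tendsto_nhds_unique (hp t) (tendsto_const_nhds.congr fun n => (hc0 n t ht).symm)
  refine ⟨p, hlip, hpK, ?_, ?_⟩
  · have h1 : Tendsto p (nhdsWithin 0 (Iio 0)) (nhds (p 0)) :=
      (hlip.continuous.tendsto 0).mono_left nhdsWithin_le_nhds
    refine tendsto_nhds_unique h1 (tendsto_const_nhds.congr' ?_)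
    filter_upwards [self_mem_nhdsWithin] with t ht using (hneg t ht).symm
  · exact tendsto_nhds_unique (hp T)
      (tendsto_const_nhds.congr fun n => (hcT n T le_rfl).symm)

end Chains

/-! ### Strict shortening -/

lemma add_mul_abs_le {k D H T : ℝ} (hk : 0 < k) (hT : 0 ≤ T)
    (h : D ^ 2 + H ^ 2 ≤ T ^ 2) : (1 - k ^ 2) * D + 2 * k * |H| ≤ (1 + k ^ 2) * T := by
  have h1 : |H| ^ 2 = H ^ 2 := sq_abs H
  have h2 : ((1 - k ^ 2) * D + 2 * k * |H|) ^ 2 ≤ ((1 + k ^ 2) * T) ^ 2 := by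
    have : ((1 - k ^ 2) * D + 2 * k * |H|) ^ 2 + (2 * k * D - (1 - k ^ 2) * |H|) ^ 2 =
        (1 + k ^ 2) ^ 2 * (D ^ 2 + H ^ 2) := by rw [← h1]; ring
    nlinarith [sq_nonneg (2 * k * D - (1 - k ^ 2) * |H|),
      mul_le_mul_of_nonneg_left h (sq_nonneg (1 + k ^ 2))]
  exact (abs_le_of_sq_le_sq' h2 (by positivity)).2

lemma exists_short_majorant {Z : Type*} [MetricSpace Z] {g : ℝ → Z} {h : ℝ → ℝ} {L b : ℝ}
    (hb : b ∈ Icc 0 L)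
    (hgh : ∀ s t, 0 ≤ s → s ≤ t → t ≤ L → dist (g s) (g t) ^ 2 + (h s - h t) ^ 2 ≤ (t - s) ^ 2)
    (h0 : h 0 = 0) (hL : h L = 0) (hbpos : 0 < h b) :
    ∃ (M : ℝ → ℝ) (B : ℝ), (∀ s t, 0 ≤ s → s ≤ t → t ≤ L → dist (g s) (g t) ≤ M t - M s) ∧
      (∀ s t, 0 ≤ s → s ≤ t → t ≤ L → M t - M s ≤ B * (t - s)) ∧ M L - M 0 < L := by
  have hL0 : 0 ≤ L := hb.1.trans hb.2
  set k := min (1 / 2) (h b / (L + 1)) with hk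
  have hk0 : 0 < k := lt_min (by norm_num) (by positivity)
  have hk1 : k < 1 := (min_le_left _ _).trans_lt (by norm_num)
  have hkL : k * L < 2 * h b := by
    have h1 : k ≤ h b / (L + 1) := min_le_right _ _
    rw [le_div_iff₀ (by positivity)] at h1
    nlinarith
  have hk2 : 0 < 1 - k ^ 2 := by nlinarith
  set H : ℝ → ℝ := fun t => if t ≤ b then h t else 2 * h b - h t with hH
  have hH1 : ∀ t ≤ b, H t = h t := fun t ht => if_pos ht
  have hH2 : ∀ t, b ≤ t → H t = 2 * h b - h t := by
    intro t ht
    rcases ht.eq_or_lt with rfl | ht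
    · rw [hH1 _ le_rfl]; ring
    · exact if_neg (not_le.2 ht)
  have hpiece : ∀ s t, 0 ≤ s → s ≤ t → t ≤ L → (t ≤ b ∨ b ≤ s) →
      dist (g s) (g t) + 2 * k / (1 - k ^ 2) * |H t - H s| ≤
        (1 + k ^ 2) / (1 - k ^ 2) * (t - s) := by
    intro s t hs hst ht hor
    have e : |H t - H s| = |h s - h t| := by
      rcases hor with hor | hor
      · rw [hH1 t hor, hH1 s (hst.trans hor), abs_sub_comm]
      · rw [hH2 s hor, hH2 t (hor.trans hst)]
        congr 1; ring
    have := add_mul_abs_le hk0 (by linarith) (hgh s t hs hst ht)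
    rw [e, div_mul_eq_mul_div, div_mul_eq_mul_div, ← mul_div_cancel_left₀ (dist (g s) (g t)) hk2.ne',
      ← add_div]
    gcongr
  have hHlip : ∀ s t, 0 ≤ s → s ≤ t → t ≤ L → (t ≤ b ∨ b ≤ s) → -(t - s) ≤ H t - H s := by
    intro s t hs hst ht hor
    have e : |H t - H s| = |h s - h t| := by
      rcases hor with hor | hor
      · rw [hH1 t hor, hH1 s (hst.trans hor), abs_sub_comm]
      · rw [hH2 s hor, hH2 t (hor.trans hst)]
        congr 1; ring
    have h1 : |h s - h t| ≤ t - s := by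
      refine abs_le_of_sq_le_sq ?_ (by linarith)
      nlinarith [hgh s t hs hst ht, sq_nonneg (dist (g s) (g t))]
    have := neg_abs_le (H t - H s)
    linarith
  set β := 2 * k / (1 - k ^ 2) with hβ
  set a := (1 + k ^ 2) / (1 - k ^ 2) with ha
  have hβ0 : 0 ≤ β := by positivity
  have hM1 : ∀ s t, 0 ≤ s → s ≤ t → t ≤ L → (t ≤ b ∨ b ≤ s) →
      dist (g s) (g t) ≤ (a * t - β * H t) - (a * s - β * H s) := by
    intro s t hs hst ht hor
    nlinarith [hpiece s t hs hst ht hor, mul_le_mul_of_nonneg_left (le_abs_self (H t - H s)) hβ0]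
  have hM2 : ∀ s t, 0 ≤ s → s ≤ t → t ≤ L → (t ≤ b ∨ b ≤ s) →
      (a * t - β * H t) - (a * s - β * H s) ≤ (a + β) * (t - s) := by
    intro s t hs hst ht hor
    nlinarith [mul_le_mul_of_nonneg_left (hHlip s t hs hst ht hor) hβ0]
  refine ⟨fun t => a * t - β * H t, a + β, fun s t hs hst ht => ?_, fun s t hs hst ht => ?_, ?_⟩
  · rcases le_total t b with h1 | h1
    · exact hM1 s t hs hst ht (Or.inl h1)
    · rcases le_total b s with h2 | h2
      · exact hM1 s t hs hst ht (Or.inr h2)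
      · have i1 := hM1 s b hs h2 hb.2 (Or.inl le_rfl)
        have i2 := hM1 b t hb.1 h1 ht (Or.inr le_rfl)
        have i3 := dist_triangle (g s) (g b) (g t)
        dsimp only
        linarith
  · rcases le_total t b with h1 | h1
    · exact hM2 s t hs hst ht (Or.inl h1)
    · rcases le_total b s with h2 | h2
      · exact hM2 s t hs hst ht (Or.inr h2)
      · have i1 := hM2 s b hs h2 hb.2 (Or.inl le_rfl)
        have i2 := hM2 b t hb.1 h1 ht (Or.inr le_rfl)
        dsimp only
        linarith
  · dsimp only
    rw [hH1 0 hb.1, hH2 L hb.2, h0, hL]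
    have e : a * L - β * (2 * h b - 0) - (a * 0 - β * 0) =
        ((1 + k ^ 2) * L - 4 * k * h b) / (1 - k ^ 2) := by
      rw [ha, hβ]; field_simp; ring
    rw [e, div_lt_iff₀ hk2]
    nlinarith

/-! ### The obstruction to splitting -/

section Splitting

variable {Z : Type*} [MetricSpace Z]

lemma frontier_biUnion_ball_subset {I : Set Z} (hI : I.Finite) (ρ : Z → ℝ) {z : Z}
    (hz : z ∈ frontier (⋃ k ∈ I, ball k (ρ k))) : ∃ k ∈ I, dist z k = ρ k := by
  rw [(isOpen_biUnion fun k _ => isOpen_ball).frontier_eq] at hz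
  obtain ⟨h1, h2⟩ := hz
  rw [hI.closure_biUnion] at h1
  simp only [mem_iUnion, mem_ball, not_exists, not_lt] at h1 h2
  obtain ⟨k, hk, hzk⟩ := h1
  exact ⟨k, hk, le_antisymm (mem_closedBall.1 (closure_ball_subset_closedBall hzk)) (h2 k hk)⟩

lemma closure_biUnion_ball_subset {I : Set Z} (hI : I.Finite) (ρ : Z → ℝ) {z : Z}
    (hz : z ∈ closure (⋃ k ∈ I, ball k (ρ k))) : ∃ k ∈ I, dist z k ≤ ρ k := by
  rw [hI.closure_biUnion] at hz
  simp only [mem_iUnion] at hz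
  obtain ⟨k, hk, hzk⟩ := hz
  exact ⟨k, hk, mem_closedBall.1 (closure_ball_subset_closedBall hzk)⟩

lemma exists_mem_Ioo_of_ae {p : ℝ → Prop} (hp : ∀ᵐ ρ : ℝ, p ρ) {a b : ℝ} (hab : a < b) :
    ∃ ρ ∈ Ioo a b, p ρ := by
  by_contra! h
  have h1 : MeasureTheory.volume (Ioo a b) = 0 := MeasureTheory.measure_mono_null
    (fun ρ hρ => h ρ hρ) hp
  rw [Real.volume_Ioo, ENNReal.ofReal_eq_zero] at h1
  linarith

open Classical in
theorem not_split_of_lifts {E N : Set Z} (hEN : IsClosed (E ∩ N)) {u : Z → ℝ}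
    (hu : Continuous u) {r : ℝ}
    (hfin : ∀ k : Z, ∀ᵐ ρ : ℝ, {z | z ∈ N ∧ u z = r ∧ dist z k = ρ}.Finite)
    {π : Z → Z} (hπ : Continuous π) (hπ1 : ∀ z, u z ≤ r → π z = z) (hπ2 : ∀ z, r < u z → u (π z) = r)
    {f : ℝ → Z} {L : ℝ} (hf : ContinuousOn f (Icc 0 L)) (hfE : ∀ t ∈ Icc 0 L, f t ∈ E)
    {ε : ℝ} (hε : 0 < ε) (hN : ∀ t ∈ Icc 0 L, ball (π (f t)) ε ⊆ N)
    (htop : ∀ Φ : Z → Circle, ContinuousOn Φ E → (∀ z ∈ E, u z ≤ r → Φ z = 1) →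
      ∀ η : ℝ → ℝ, ContinuousOn η (Icc 0 L) → η 0 = 0 → η L = 1 →
      ∃ t ∈ Icc 0 L, Φ (f t) ≠ Circle.exp (2 * Real.pi * η t))
    {K₁ K₂ : Set Z} (hK₁ : IsCompact K₁) (hK₂ : IsCompact K₂) (hdisj : Disjoint K₁ K₂)
    (hK : K₁ ∪ K₂ = E ∩ (fun t => π (f t)) '' Icc 0 L) (hx : π (f 0) ∈ K₁) (hy : π (f L) ∈ K₂) :
    False := by
  set G := (fun t => π (f t)) '' Icc 0 L with hG
  have hg : ContinuousOn (fun t => π (f t)) (Icc 0 L) := hπ.comp_continuousOn hf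
  have hGN : ∀ z ∈ G, ball z ε ⊆ N := by
    rintro _ ⟨t, ht, rfl⟩
    exact hN t ht
  have hGS : ∀ z ∈ G, z ∉ E → u z = r := by
    rintro _ ⟨t, ht, rfl⟩ hz
    rcases le_or_gt (u (f t)) r with h | h
    · exact absurd (hfE t ht) (by simpa only [hπ1 _ h] using hz)
    · exact hπ2 _ h
  -- a finite union of balls around `K₂` with generic radii
  obtain ⟨ε₀, hε₀, hthick⟩ := hdisj.exists_thickenings hK₁ hK₂.isClosed
  have hdist : ∀ z ∈ K₁, ∀ k ∈ K₂, ε₀ ≤ dist z k := by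
    intro z hz k hk
    by_contra! h
    exact Set.disjoint_left.1 hthick (mem_thickening_iff.2 ⟨z, hz, by rw [dist_self]; exact hε₀⟩)
      (mem_thickening_iff.2 ⟨k, hk, h⟩)
  have hρex : ∀ k, ∃ ρ ∈ Ioo 0 ε₀, {z | z ∈ N ∧ u z = r ∧ dist z k = ρ}.Finite := fun k =>
    exists_mem_Ioo_of_ae (hfin k) hε₀
  choose ρ hρ hρfin using hρex
  obtain ⟨I, hIK, hI, hIcov⟩ := hK₂.elim_finite_subcover_image (b := K₂) (c := fun k => ball k (ρ k))
    (fun k _ => isOpen_ball) (fun k hk => mem_biUnion hk (mem_ball_self (hρ k).1))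
  set D := ⋃ k ∈ I, ball k (ρ k) with hD
  have hDK₁ : ∀ z ∈ K₁, z ∉ closure D := by
    intro z hz hzD
    obtain ⟨k, hk, hzk⟩ := closure_biUnion_ball_subset hI ρ hzD
    linarith [hdist z hz k (hIK hk), (hρ k).2]
  have hDopen : IsOpen D := isOpen_biUnion fun k _ => isOpen_ball
  have hfrE : ∀ z ∈ G, z ∈ frontier D → z ∉ E := by
    intro z hz hzD hzE
    have : z ∈ K₁ ∪ K₂ := hK ▸ ⟨hzE, hz⟩
    rcases this with h | h
    · exact hDK₁ z h (frontier_subset_closure hzD)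
    · rw [hDopen.frontier_eq] at hzD
      exact hzD.2 (hIcov h)
  set Q := {z | z ∈ N ∧ u z = r ∧ ∃ k ∈ I, dist z k = ρ k} with hQ
  have hQfin : Q.Finite := by
    refine (hI.biUnion fun k _ => hρfin k).subset ?_
    rintro z ⟨h1, h2, k, hk, h3⟩
    exact mem_biUnion hk ⟨h1, h2, h3⟩
  have hQmem : ∀ z ∈ N, u z = r → z ∈ frontier D → z ∈ Q := fun z h1 h2 h3 =>
    ⟨h1, h2, frontier_biUnion_ball_subset hI ρ h3⟩
  set Q' := G ∩ frontier D with hQ'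
  have hQ'fin : Q'.Finite := hQfin.subset fun z hz =>
    hQmem z (hGN z hz.1 (mem_ball_self hε)) (hGS z hz.1 (hfrE z hz.1 hz.2)) hz.2
  -- small balls around the frontier points
  have hσex : ∀ q, q ∈ Q' → ∃ σ > 0, closedBall q σ ⊆ N \ E ∧ ∀ q' ∈ Q, dist q' q ≠ σ := by
    intro q hq
    have hqE : q ∈ (E ∩ N)ᶜ := fun h => hfrE q hq.1 hq.2 h.1
    obtain ⟨δ, hδ, hball⟩ := Metric.isOpen_iff.1 hEN.isOpen_compl q hqE
    obtain ⟨σ, hσ, hσ'⟩ := ((Ioo_infinite (lt_min hδ hε)).sdiff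
      (hQfin.image fun q' => dist q' q)).nonempty
    refine ⟨σ, hσ.1, fun z hz => ?_, fun q' hq' h => hσ' ⟨q', hq', h⟩⟩
    have hzN : z ∈ N := hGN q hq.1 (mem_ball.2 ((mem_closedBall.1 hz).trans_lt
      (hσ.2.trans_le (min_le_right _ _))))
    refine ⟨hzN, fun hzE => hball (mem_ball.2 ((mem_closedBall.1 hz).trans_lt
      (hσ.2.trans_le (min_le_left _ _)))) ⟨hzE, hzN⟩⟩
  choose! σ hσ hσNE hσQ using hσex
  set W := ⋃ q ∈ Q', ball q (σ q) with hW
  have hWopen : IsOpen W := isOpen_biUnion fun k _ => isOpen_ball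
  have hQ'W : ∀ z ∈ Q', z ∈ W := fun z hz => mem_biUnion hz (mem_ball_self (hσ z hz))
  have hWcl : ∀ z ∈ closure W, z ∈ N ∧ z ∉ E := by
    intro z hz
    obtain ⟨q, hq, hzq⟩ := closure_biUnion_ball_subset hQ'fin σ hz
    exact hσNE q hq (mem_closedBall.2 hzq)
  have hEW : ∀ z ∈ E, z ∉ W := fun z hz hzW => (hWcl z (subset_closure hzW)).2 hz
  have hWQ : ∀ z ∈ frontier W, z ∉ Q := by
    intro z hz hzQ
    obtain ⟨q, hq, hzq⟩ := frontier_biUnion_ball_subset hQ'fin σ hz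
    exact hσQ q hq z hzQ hzq
  have hSclosed : IsClosed {z | u z = r} := isClosed_eq hu continuous_const
  obtain ⟨θ, hθ0, hθ1, -⟩ := exists_continuous_zero_one_of_isClosed
    (s := ({z | u z = r} ∩ Dᶜ) ∩ frontier W) (t := (closure D ∩ {z | u z = r}) ∩ frontier W)
    ((hSclosed.inter hDopen.isClosed_compl).inter isClosed_frontier)
    ((isClosed_closure.inter hSclosed).inter isClosed_frontier) (by
      rw [Set.disjoint_left]
      rintro z ⟨⟨h1, h2⟩, h3⟩ ⟨⟨h4, -⟩, -⟩
      refine hWQ z h3 (hQmem z (hWcl z (frontier_subset_closure h3)).1 h1 ?_)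
      rw [hDopen.frontier_eq]
      exact ⟨h4, h2⟩)
  set χ : Z → ℝ := D.piecewise (fun _ => 1) (fun _ => 0) with hχ
  set ηt : Z → ℝ := W.piecewise θ χ with hηt
  have hχ01 : ∀ z, Circle.exp (2 * Real.pi * χ z) = 1 := by
    intro z
    by_cases hz : z ∈ D
    · simp [hχ, hz]
    · simp [hχ, hz]
  have hθχ : ∀ z, u z = r → z ∈ frontier W → θ z = χ z := by
    intro z h1 h2
    by_cases hz : z ∈ D
    · rw [hθ1 ⟨⟨subset_closure hz, h1⟩, h2⟩]; simp [hχ, hz]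
    · rw [hθ0 ⟨⟨h1, hz⟩, h2⟩]; simp [hχ, hz]
  have hηW : ∀ z, z ∉ W → ηt z = χ z := fun z hz => piecewise_eq_of_notMem _ _ _ hz
  have hηcont : ContinuousOn ηt G := by
    refine ContinuousOn.piecewise ?_ θ.continuous.continuousOn ?_
    · rintro z ⟨h1, h2⟩
      exact hθχ z (hGS z h1 (hWcl z (frontier_subset_closure h2)).2) h2
    · rw [hWopen.isClosed_compl.closure_eq]
      refine ContinuousOn.piecewise ?_ continuousOn_const continuousOn_const
      rintro z ⟨⟨h1, h2⟩, h3⟩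
      exact absurd (hQ'W z ⟨h1, h3⟩) h2
  set Ψ : Z → Circle := W.piecewise (fun z => Circle.exp (2 * Real.pi * θ z)) (fun _ => 1) with hΨ
  have hΨη : ∀ z, Ψ z = Circle.exp (2 * Real.pi * ηt z) := by
    intro z
    by_cases hz : z ∈ W
    · simp [hΨ, hηt, hz]
    · rw [hηW z hz, hχ01]; simp [hΨ, hz]
  have hΨcont : ContinuousOn Ψ {z | u z = r} := by
    refine ContinuousOn.piecewise ?_ ?_ continuousOn_const
    · rintro z ⟨h1, h2⟩
      rw [hθχ z h1 h2, hχ01]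
    · exact (Circle.exp.continuous.comp (continuous_const.mul θ.continuous)).continuousOn
  set Φ : Z → Circle := {z | u z ≤ r}.piecewise (fun _ => 1) (fun z => Ψ (π z)) with hΦ
  have hS' : ∀ z, r ≤ u z → u (π z) = r := by
    intro z hz
    rcases hz.eq_or_lt with h | h
    · rw [hπ1 z h.symm.le]; exact h.symm
    · exact hπ2 z h
  have hΦcont : ContinuousOn Φ E := by
    refine ContinuousOn.piecewise ?_ continuousOn_const ?_
    · rintro z ⟨h1, h2⟩
      have h3 : u z = r := frontier_le_subset_eq hu continuous_const h2
      rw [hπ1 z h3.le]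
      simp [hΨ, hEW z h1]
    · refine hΨcont.comp hπ.continuousOn ?_
      rintro z ⟨h1, h2⟩
      refine hS' z ?_
      have : closure {z | u z ≤ r}ᶜ ⊆ {z | r ≤ u z} :=
        closure_minimal (fun w hw => (not_le.1 (show ¬ u w ≤ r from hw)).le) (isClosed_le continuous_const hu)
      exact this h2
  have hxE : π (f 0) ∈ E := by
    have : π (f 0) ∈ K₁ ∪ K₂ := Or.inl hx
    rw [hK] at this
    exact this.1
  have hyE : π (f L) ∈ E := by
    have : π (f L) ∈ K₁ ∪ K₂ := Or.inr hy
    rw [hK] at this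
    exact this.1
  obtain ⟨t, ht, hne⟩ := htop Φ hΦcont (fun z _ hz => by simp [hΦ, hz]) (fun t => ηt (π (f t)))
    (hηcont.comp hg fun t ht => ⟨t, ht, rfl⟩) (by
      rw [hηW _ (hEW _ hxE)]
      have : π (f 0) ∉ D := fun h => hDK₁ _ hx (subset_closure h)
      simp [hχ, this]) (by
      rw [hηW _ (hEW _ hyE)]
      have : π (f L) ∈ D := hIcov hy
      simp [hχ, this])
  apply hne
  by_cases h : u (f t) ≤ r
  · rw [hπ1 _ h, hηW _ (hEW _ (hfE t ht)), hχ01]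
    simp [hΦ, h]
  · rw [← hΨη]
    simp [hΦ, h]

end Splitting

/-! ### Shortest paths between points of a convex set -/

section Shortest

variable {Z : Type*} [MetricSpace Z]

theorem mem_convex_of_shortest [CompleteSpace Z] (hZ : HasStewartPoints Z) {C : Set Z}
    (hCcl : IsClosed C) (hC : StewartConvex C) {E N : Set Z} (hEN : IsClosed (E ∩ N))
    (hNcov : HasQuadraticCover N) {f : ℝ → Z} {L ε : ℝ} (hL : 0 ≤ L) (hε : 0 < ε)
    (hf : ∀ s ∈ Icc 0 L, ∀ t ∈ Icc 0 L, dist (f s) (f t) ≤ |s - t|)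
    (hfE : ∀ t ∈ Icc 0 L, f t ∈ E) (hfN : ∀ t ∈ Icc 0 L, ball (f t) ε ⊆ N)
    (h0C : f 0 ∈ C) (hLC : f L ∈ C)
    (htop : ∀ Φ : Z → Circle, ContinuousOn Φ E → (∀ z ∈ E, z ∈ C → Φ z = 1) →
      ∀ η : ℝ → ℝ, ContinuousOn η (Icc 0 L) → η 0 = 0 → η L = 1 →
      ∃ t ∈ Icc 0 L, Φ (f t) ≠ Circle.exp (2 * Real.pi * η t))
    (hmin : ∀ (c : ℝ → Z) (T : ℝ), LipschitzWith 1 c → (∀ t, c t ∈ E) → c 0 = f 0 → c T = f L →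
      0 ≤ T → L ≤ T) :
    ∀ t ∈ Icc 0 L, f t ∈ C := by
  intro t₀ ht₀
  by_contra hnot
  have hne : C.Nonempty := ⟨_, h0C⟩
  set u : Z → ℝ := fun z => infDist z C with hu
  have hulip : LipschitzWith 1 u := lipschitz_infDist_pt C
  have hfcont : ContinuousOn f (Icc 0 L) := by
    rw [Metric.continuousOn_iff]
    intro t ht δ hδ
    exact ⟨δ, hδ, fun s hs hst => (hf s hs t ht).trans_lt hst⟩
  obtain ⟨b, hb, hbmax⟩ := isCompact_Icc.exists_isMaxOn ⟨t₀, ht₀⟩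
    (hulip.continuous.comp_continuousOn hfcont)
  set R := u (f b) with hR
  have hbR : ∀ t ∈ Icc 0 L, u (f t) ≤ R := fun t ht => hbmax ht
  have hR0 : 0 < R :=
    ((hCcl.notMem_iff_infDist_pos hne).1 hnot).trans_le (hbR t₀ ht₀)
  set s := min (1 / 2) (ε / (8 * R)) with hs
  have hs0 : 0 < s := lt_min (by norm_num) (by positivity)
  have hs1 : s ≤ 1 / 2 := min_le_left _ _
  have hsR : s * R ≤ ε / 8 := by
    have : s ≤ ε / (8 * R) := min_le_right _ _
    rw [le_div_iff₀ (by positivity)] at this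
    linarith
  obtain ⟨r, hr, hrfin⟩ := exists_mem_Ioo_of_ae (hNcov.ae_finite hulip)
    (show (1 - s) * R < R by nlinarith)
  have hr0 : 0 < r := lt_trans (by nlinarith) hr.1
  set C' := {z | infDist z C ≤ r} with hC'
  have hC'cl : IsClosed C' := isClosed_le (continuous_infDist_pt C) continuous_const
  have hC'conv : StewartConvex C' := hC.infDist_le hZ hne r
  have hCC' : C ⊆ C' := fun z hz => by
    change infDist z C ≤ r
    rw [infDist_zero_of_mem hz]; exact hr0.le
  choose π hπ using exists_isNearest hZ hC'conv (hne.mono hCC') hC'cl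
  have hπlip : LipschitzWith 1 π := LipschitzWith.of_dist_le_mul fun z w => by
    rw [NNReal.coe_one, one_mul]; exact (hπ z).dist_le hZ hC'conv (hπ w)
  have hπ1 : ∀ z, u z ≤ r → π z = z := fun z hz => (hπ z).eq_of_mem hz
  have hπ2 : ∀ z, r < u z → u (π z) = r := fun z hz => (hπ z).infDist_eq hZ hz
  have hclose : ∀ t ∈ Icc 0 L, dist (f t) (π (f t)) < ε / 2 := by
    intro t ht
    obtain ⟨w, hw, hdw⟩ := exists_infDist_le_dist_le hZ hne ⟨hs0, by linarith⟩ hr.1 (hbR t ht)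
    have h1 := (hπ (f t)).2 w hw
    refine (h1.trans hdw).trans_lt ?_
    rw [div_lt_iff₀ (by linarith)]
    nlinarith [hr.2]
  have hπN : ∀ t ∈ Icc 0 L, ball (π (f t)) (ε / 2) ⊆ N := by
    intro t ht z hz
    refine hfN t ht (mem_ball.2 ?_)
    have h1 := dist_triangle_right z (f t) (π (f t))
    have h2 := hclose t ht
    have h3 := mem_ball.1 hz
    linarith
  obtain ⟨M, B, hM1, hM2, hM3⟩ := exists_short_majorant (g := fun t => π (f t))
    (h := fun t => dist (f t) (π (f t))) hb
    (fun s t hs hst ht => by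
      have h1 := (hπ (f s)).sq_dist_add_sq_le hZ hC'conv (hπ (f t))
      have h2 := hf s ⟨hs, hst.trans ht⟩ t ⟨hs.trans hst, ht⟩
      rw [abs_sub_comm, abs_of_nonneg (by linarith)] at h2
      exact h1.trans (pow_le_pow_left₀ dist_nonneg h2 2))
    (by rw [(hπ (f 0)).eq_of_mem (hCC' h0C), dist_self])
    (by rw [(hπ (f L)).eq_of_mem (hCC' hLC), dist_self])
    (by
      rw [dist_pos]
      intro h
      have h1 : u (f b) ≤ r := by
        have := (hπ (f b)).1
        rwa [← h] at this
      linarith [hr.2])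
  set G := (fun t => π (f t)) '' Icc 0 L with hG
  have hGcomp : IsCompact G := isCompact_Icc.image_of_continuousOn
    (hπlip.continuous.comp_continuousOn hfcont)
  have hKcomp : IsCompact (E ∩ G) := by
    have : E ∩ G = G ∩ (E ∩ N) := by
      ext z
      constructor
      · rintro ⟨h1, h2⟩
        obtain ⟨t, ht, rfl⟩ := id h2
        exact ⟨h2, h1, hπN t ht (mem_ball_self (by linarith))⟩
      · rintro ⟨h1, h2, -⟩
        exact ⟨h2, h1⟩
    rw [this]
    exact hGcomp.inter_right hEN
  have hg0 : π (f 0) = f 0 := (hπ (f 0)).eq_of_mem (hCC' h0C)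
  have hgL : π (f L) = f L := (hπ (f L)).eq_of_mem (hCC' hLC)
  have h0mem : (0 : ℝ) ∈ Icc 0 L := ⟨le_rfl, hL⟩
  have hLmem : L ∈ Icc 0 L := ⟨hL, le_rfl⟩
  obtain ⟨T, hT1, hT2⟩ := exists_between hM3
  obtain ⟨c, hc, hcK, hc0, hcT⟩ := exists_lipschitz_path_of_not_split hL hKcomp hM1 hM2 hT1
    inter_subset_right (x := f 0) (y := f L) ⟨hfE 0 h0mem, 0, h0mem, hg0⟩
    ⟨hfE L hLmem, L, hLmem, hgL⟩
    (fun K₁ K₂ hK₁ hK₂ hdisj hK hx hy =>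
      not_split_of_lifts hEN hulip.continuous hrfin hπlip.continuous hπ1 hπ2 hfcont hfE
        (half_pos hε) hπN
        (fun Φ h1 h2 => htop Φ h1 fun z hz hzC => h2 z hz (hCC' hzC))
        hK₁ hK₂ hdisj hK (hg0.symm ▸ hx) (hgL.symm ▸ hy))
  have hT0 : 0 ≤ T := by
    have := dist_nonneg.trans (hM1 0 L le_rfl hL le_rfl)
    linarith
  exact absurd (hmin c T hc (fun t => (hcK t).1) hc0 hcT hT0) (not_le.2 hT2)

end Shortest

/-! ### Circle-valued maps on spaces with trivial first homology -/

section Lifts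

open scoped unitInterval

lemma H1Trivial.lift_endpoints_eq {B : Type*} [TopologicalSpace B] (hB : H1Trivial B)
    (Φ : C(B, Circle)) {x : B} (p : Path x x) (η : C(I, ℝ))
    (hη : ∀ t, Φ (p t) = Circle.exp (η t)) : η 1 = η 0 := by
  have hcov := Circle.isAddQuotientCoveringMap_exp
  have he : Circle.exp (η 0) = Φ x := by rw [← hη 0, p.source]
  let e : Circle.exp ⁻¹' {Φ x} := ⟨η 0, he⟩
  let ψ := (hcov.fundamentalGroupToMulOpposite e).comp (FundamentalGroup.map Φ x)
  have h1 : ψ (FundamentalGroup.fromPath ⟦p⟧) = 1 := by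
    have h2 : Abelianization.lift ψ (loopClassH1 p) = 1 := by rw [hB x p, map_one]
    rwa [loopClassH1, Abelianization.lift_apply_of] at h2
  have h3 := hcov.fundamentalGroupToMulOpposite_eq_one_iff.1 h1
  have h4 : hcov.isCoveringMap.liftPath ((p.map Φ.continuous : Path (Φ x) (Φ x)) : C(I, Circle))
      (η 0) (by simp [he]) 1 = η 0 := congrArg Subtype.val h3
  have h5 : η = hcov.isCoveringMap.liftPath
      ((p.map Φ.continuous : Path (Φ x) (Φ x)) : C(I, Circle)) (η 0) (by simp [he]) :=
    (hcov.isCoveringMap.eq_liftPath_iff' _).2 ⟨funext fun t => (hη t).symm, rfl⟩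
  rw [← h5] at h4
  exact h4

lemma H1Trivial.exists_ne_exp {X : Type*} [TopologicalSpace X] {E C : Set X}
    (hE : H1Trivial ↥E) {f : ℝ → X} {L : ℝ} (hL : 0 ≤ L) (hf : ContinuousOn f (Icc 0 L))
    (hfE : ∀ t ∈ Icc 0 L, f t ∈ E) (hjoin : JoinedIn (E ∩ C) (f L) (f 0))
    {Φ : X → Circle} (hΦ : ContinuousOn Φ E) (hΦC : ∀ z ∈ E, z ∈ C → Φ z = 1)
    {η : ℝ → ℝ} (hη : ContinuousOn η (Icc 0 L)) (h0 : η 0 = 0) (h1 : η L = 1) :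
    ∃ t ∈ Icc 0 L, Φ (f t) ≠ Circle.exp (2 * Real.pi * η t) := by
  by_contra! hall
  have hmem : ∀ t : I, L * t ∈ Icc 0 L := fun t =>
    ⟨mul_nonneg hL t.2.1, mul_le_of_le_one_right hL t.2.2⟩
  have hcont : Continuous fun t : I => L * (t : ℝ) := by fun_prop
  let x₀ : E := ⟨f 0, hfE 0 ⟨le_rfl, hL⟩⟩
  let x₁ : E := ⟨f L, hfE L ⟨hL, le_rfl⟩⟩
  let p : Path x₀ x₁ :=
    { toFun := fun t => ⟨f (L * t), hfE _ (hmem t)⟩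
      continuous_toFun := (hf.comp_continuous hcont hmem).subtype_mk _
      source' := by simp [x₀]
      target' := by simp [x₁] }
  let q : Path x₁ x₀ :=
    { toFun := fun t => ⟨hjoin.somePath t, (hjoin.somePath_mem t).1⟩
      continuous_toFun := hjoin.somePath.continuous.subtype_mk _
      source' := by simp [x₁]
      target' := by simp [x₀] }
  let ηp : Path (0 : ℝ) (2 * Real.pi) :=
    { toFun := fun t => 2 * Real.pi * η (L * t)
      continuous_toFun := continuous_const.mul (hη.comp_continuous hcont hmem)
      source' := by simp [h0]
      target' := by simp [h1] }
  let Φ' : C(E, Circle) := ⟨fun z => Φ z, continuousOn_iff_continuous_domRestrict.1 hΦ⟩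
  have key := hE.lift_endpoints_eq Φ' (p.trans q) (ηp.trans (Path.refl _) : C(I, ℝ)) (by
    intro t
    change Φ' (p.trans q t) = Circle.exp (ηp.trans (Path.refl _) t)
    rw [Path.trans_apply, Path.trans_apply]
    split_ifs with h
    · exact hall _ (hmem _)
    · have := hjoin.somePath_mem ⟨2 * (t : ℝ) - 1, unitInterval.two_mul_sub_one_mem_iff.2
        ⟨(not_le.1 h).le, t.2.2⟩⟩
      rw [Path.refl_apply, Circle.exp_two_pi]
      exact hΦC _ this.1 this.2)
  simp at key

end Lifts

/-! ### Angle comparison implies Stewart's inequality -/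

lemma cosh_le_of_sq_eq {c p q r : ℝ} (hr : r ∈ Icc (0 : ℝ) 1)
    (h : c ^ 2 = (1 - r) * p ^ 2 + r * q ^ 2) :
    Real.cosh c ≤ (1 - r) * Real.cosh p + r * Real.cosh q := by
  refine hasSum_le (fun n => ?_) (Real.hasSum_cosh c)
    (((Real.hasSum_cosh p).mul_left (1 - r)).add ((Real.hasSum_cosh q).mul_left r))
  have hconv := (convexOn_pow n).2 (mem_Ici.2 (sq_nonneg p)) (mem_Ici.2 (sq_nonneg q))
    (sub_nonneg.2 hr.2) hr.1 (by ring)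
  simp only [smul_eq_mul] at hconv
  rw [← h] at hconv
  rw [pow_mul, pow_mul, pow_mul, ← mul_div_assoc, ← mul_div_assoc, ← add_div]
  gcongr

lemma eucl_cos_le_hyperbolic_cos {a b c : ℝ} (ha : 0 < a) (hb : 0 < b) (hc : 0 ≤ c)
    (h1 : a ≤ b + c) (h2 : b ≤ a + c) (h3 : c ≤ a + b) :
    (a ^ 2 + b ^ 2 - c ^ 2) / (2 * a * b) ≤
      (Real.cosh a * Real.cosh b - Real.cosh c) / (Real.sinh a * Real.sinh b) := by
  have hab : 0 < a * b := mul_pos ha hb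
  set r := (c ^ 2 - (a - b) ^ 2) / (4 * (a * b)) with hr
  have hr' : r * (4 * (a * b)) = c ^ 2 - (a - b) ^ 2 := by rw [hr]; field_simp
  have hr0 : r ∈ Icc (0 : ℝ) 1 := by
    constructor
    · apply div_nonneg _ (by positivity)
      nlinarith
    · rw [hr, div_le_one (by positivity)]
      nlinarith
  have hcosh := cosh_le_of_sq_eq (c := c) (p := a - b) (q := a + b) hr0 (by nlinarith)
  rw [Real.cosh_sub, Real.cosh_add] at hcosh
  have hsa := Real.sinh_pos_iff.2 ha
  have hsb := Real.sinh_pos_iff.2 hb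
  have hL : (a ^ 2 + b ^ 2 - c ^ 2) / (2 * a * b) = 1 - 2 * r := by
    rw [div_eq_iff (by positivity)]
    nlinarith
  rw [hL, le_div_iff₀ (mul_pos hsa hsb)]
  nlinarith

lemma compAngle_le_euclCompAngle {κ a b c : ℝ} (hκ : κ ≤ 0) (ha : 0 < a) (hb : 0 < b)
    (hc : 0 ≤ c) (h1 : a ≤ b + c) (h2 : b ≤ a + c) (h3 : c ≤ a + b) :
    compAngle κ a b c ≤ euclCompAngle a b c := by
  unfold compAngle
  split_ifs with h
  · exact le_rfl
  · have hk : 0 < √(-κ) := Real.sqrt_pos.2 (by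
      have := lt_of_le_of_ne hκ h
      linarith)
    set k := √(-κ)
    refine Real.antitone_arccos ?_
    have := eucl_cos_le_hyperbolic_cos (mul_pos hk ha) (mul_pos hk hb) (mul_nonneg hk.le hc)
      (by nlinarith) (by nlinarith) (by nlinarith)
    refine le_trans (le_of_eq ?_) this
    field_simp

lemma exists_sq_lt_of_upperAngle_lt {X : Type*} [MetricSpace X] {p : X} {σ τ : ℝ → X} {l A : ℝ}
    (hl : 0 < l) (hσ : ∀ s ∈ Icc 0 l, dist p (σ s) = s) (hτ : ∀ s ∈ Icc 0 l, dist p (τ s) = s)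
    (h : upperAngleWrt (xDist X) p σ τ < Real.arccos A) :
    ∃ ε > 0, ∀ s t, 0 < s → s < ε → 0 < t → t < ε →
      dist (σ s) (τ t) ^ 2 < s ^ 2 + t ^ 2 - 2 * s * t * A := by
  unfold upperAngleWrt at h
  obtain ⟨_, ⟨ε, hε, rfl⟩, hlt⟩ := exists_lt_of_csInf_lt (by exact ⟨_, 1, one_pos, rfl⟩) h
  refine ⟨min ε l, lt_min hε hl, fun s t hs hs' ht ht' => ?_⟩
  rw [lt_min_iff] at hs' ht'
  have hle := le_csSup (s := {b | ∃ s t : ℝ, 0 < s ∧ s < ε ∧ 0 < t ∧ t < ε ∧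
      b = euclCompAngle (xDist X p (σ s)) (xDist X p (τ t)) (xDist X (σ s) (τ t))})
    ⟨Real.pi, by rintro _ ⟨s, t, -, -, -, -, rfl⟩; exact Real.arccos_le_pi _⟩
    ⟨s, t, hs, hs'.1, ht, ht'.1, rfl⟩
  have hlt' := hle.trans_lt hlt
  simp only [xDist] at hlt'
  rw [hσ s ⟨hs.le, hs'.2.le⟩, hτ t ⟨ht.le, ht'.2.le⟩] at hlt'
  have : A < (s ^ 2 + t ^ 2 - dist (σ s) (τ t) ^ 2) / (2 * s * t) := by
    by_contra! hcon
    exact absurd (Real.antitone_arccos hcon) (not_le.2 hlt')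
  rw [lt_div_iff₀ (by positivity)] at this
  linarith

lemma div_le_one_of_triangle {a c x : ℝ} (ha : 0 < a) (hc : 0 < c)
    (h1 : a ≤ c + x) (h2 : c ≤ a + x) : (a ^ 2 + c ^ 2 - x ^ 2) / (2 * a * c) ≤ 1 := by
  rw [div_le_one (by positivity)]
  nlinarith

lemma not_two_mul_le_add_of_sq_lt {s δ u v d₁ d₂ : ℝ} (hs : 0 < s) (hδ : 0 < δ)
    (hδuv : δ ≤ u + v) (h₁ : d₁ ^ 2 < s ^ 2 + (δ * s) ^ 2 - 2 * s * (δ * s) * u)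
    (h₂ : d₂ ^ 2 < s ^ 2 + (δ * s) ^ 2 - 2 * s * (δ * s) * v) : ¬ 2 * s ≤ d₁ + d₂ := by
  intro h
  have e5 : 4 * s ^ 2 ≤ 2 * (d₁ ^ 2 + d₂ ^ 2) := by
    nlinarith [sq_nonneg (d₁ - d₂), pow_le_pow_left₀ (by linarith : 0 ≤ 2 * s) h 2]
  have e7 : 0 ≤ δ * s ^ 2 * (u + v - δ) := mul_nonneg (by positivity) (by linarith)
  nlinarith

lemma IsCATSpace.stewart_of_geodesic {κ : ℝ} (hκ : κ ≤ 0) {X : Type*} [MetricSpace X]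
    (hX : IsCATSpace κ X) {x y : X} {σ : ℝ → X}
    (hσ : IsGeodesicFromTo (xDist X) univ σ x y) {t : ℝ} (ht : t ∈ Icc (0 : ℝ) 1) :
    IsStewartPoint x y t (σ (t * dist x y)) := by
  intro z
  obtain ⟨hσ0, hσ1, ⟨-, hgeo⟩, -⟩ := hσ
  simp only [xDist] at hσ1 hgeo
  set D := dist x y with hD
  set m := σ (t * D) with hm
  have hD0 : 0 ≤ D := dist_nonneg
  have htD : t * D ∈ Icc 0 D := ⟨mul_nonneg ht.1 hD0, mul_le_of_le_one_left hD0 ht.2⟩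
  have hmx : dist m x = t * D := by
    rw [hm, ← hσ0, hgeo _ htD 0 ⟨le_rfl, hD0⟩, sub_zero, abs_of_nonneg htD.1]
  have hmy : dist m y = (1 - t) * D := by
    conv_lhs => rw [hm, ← hσ1, hgeo _ htD D ⟨hD0, le_rfl⟩, abs_sub_comm,
      abs_of_nonneg (sub_nonneg.2 htD.2)]
    ring
  rcases hD0.eq_or_lt with hD0' | hDpos
  · rw [← hD0'] at hmx
    rw [mul_zero, dist_eq_zero] at hmx
    have : x = y := by rw [← dist_eq_zero, ← hD, ← hD0']
    rw [hmx, ← this, ← hD0']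
    nlinarith
  rcases ht.1.eq_or_lt with ht0 | ht0
  · rw [← ht0, zero_mul, dist_eq_zero] at hmx
    rw [hmx, ← ht0]; nlinarith
  rcases ht.2.eq_or_lt with ht1 | ht1
  · rw [ht1, sub_self, zero_mul, dist_eq_zero] at hmy
    rw [hmy, ht1]; nlinarith
  have ha : 0 < t * D := mul_pos ht0 hDpos
  have hb : 0 < (1 - t) * D := mul_pos (sub_pos.2 ht1) hDpos
  by_cases hzx : z = x
  · rw [hzx, dist_comm x m, hmx, dist_self, ← hD]; nlinarith
  by_cases hzy : z = y
  · rw [hzy, dist_comm y m, hmy, dist_self, dist_comm y x, ← hD]; nlinarith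
  have hX0 := dist_nonneg (x := z) (y := x)
  have hY0 := dist_nonneg (x := z) (y := y)
  have tx1 := dist_triangle m z x
  have tx2 := dist_triangle z x m
  have tx3 := dist_triangle_left z x m
  have ty1 := dist_triangle m z y
  have ty2 := dist_triangle z y m
  have ty3 := dist_triangle_left z y m
  rw [dist_comm x m] at tx2
  rw [dist_comm y m] at ty2
  have tDxy := dist_triangle_left x y z
  rw [← hD] at tDxy
  have htri1 := dist_triangle_left x y m
  by_cases hzm : z = m
  · rw [hzm, dist_self, hmx, hmy]; nlinarith
  have hc : 0 < dist m z := dist_pos.2 (Ne.symm hzm)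
  rw [dist_comm z m] at tx2 ty2 ⊢
  rw [hmx] at tx1 tx2 tx3
  rw [hmy] at ty1 ty2 ty3
  obtain ⟨τ, hτ⟩ := hX.1 m trivial z trivial
  have hτ' := hτ
  obtain ⟨hτ0, hτ1, ⟨-, hτgeo⟩, -⟩ := hτ
  simp only at hτ1 hτgeo
  set c := dist m z with hcdef
  set a := t * D with ha_def
  set b := (1 - t) * D with hb_def
  have hab : a + b = D := by rw [ha_def, hb_def]; ring
  have hσm : IsGeodesicFromTo (xDist X) univ (fun s => σ (a - s)) m x := by
    refine ⟨by simp [hm], by simp [hmx, hσ0], ⟨dist_nonneg, ?_⟩, fun _ _ => trivial⟩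
    simp only [xDist, hmx]
    intro s hs r hr
    rw [hgeo _ ⟨by linarith [hs.2], by linarith [hs.1]⟩ _ ⟨by linarith [hr.2], by linarith [hr.1]⟩,
      abs_sub_comm]
    congr 1; ring
  have hσp : IsGeodesicFromTo (xDist X) univ (fun s => σ (a + s)) m y := by
    refine ⟨by simp [hm], by simp [hmy, hab, hσ1], ⟨dist_nonneg, ?_⟩, fun _ _ => trivial⟩
    simp only [xDist, hmy]
    intro s hs r hr
    rw [hgeo _ ⟨by linarith [hs.1], by linarith [hs.2]⟩ _ ⟨by linarith [hr.1], by linarith [hr.2]⟩]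
    congr 1; ring
  have hmnx : m ≠ x := by rw [← dist_pos, hmx]; exact ha
  have hmny : m ≠ y := by rw [← dist_pos, hmy]; exact hb
  have hangx := hX.2 m trivial x trivial z trivial hmnx (Ne.symm hzm) (Ne.symm hzx) _ _ hσm hτ'
  have hangy := hX.2 m trivial y trivial z trivial hmny (Ne.symm hzm) (Ne.symm hzy) _ _ hσp hτ'
  simp only [hmx, hmy, ← hcdef, dist_comm x z, dist_comm y z] at hangx hangy
  replace hangx := hangx.trans (compAngle_le_euclCompAngle hκ ha hc hX0 tx1 (by linarith)
    (by linarith))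
  replace hangy := hangy.trans (compAngle_le_euclCompAngle hκ hb hc hY0 ty1 (by linarith)
    (by linarith))
  unfold euclCompAngle at hangx hangy
  set u := (a ^ 2 + c ^ 2 - dist z x ^ 2) / (2 * a * c) with hu
  set v := (b ^ 2 + c ^ 2 - dist z y ^ 2) / (2 * b * c) with hv
  have hu1 : u ≤ 1 := div_le_one_of_triangle ha hc tx1 (by linarith)
  have hv1 : v ≤ 1 := div_le_one_of_triangle hb hc ty1 (by linarith)
  have hu' : u * (2 * a * c) = a ^ 2 + c ^ 2 - dist z x ^ 2 := by rw [hu]; field_simp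
  have hv' : v * (2 * b * c) = b ^ 2 + c ^ 2 - dist z y ^ 2 := by rw [hv]; field_simp
  have huv : u + v ≤ 0 := by
    by_contra! hpos
    obtain ⟨δ, hδ, hδu⟩ : ∃ δ > 0, δ = (u + v) / 4 := ⟨_, by linarith, rfl⟩
    have hltx : upperAngleWrt (xDist X) m (fun s => σ (a - s)) τ < Real.arccos (u - δ) :=
      hangx.trans_lt (Real.strictAntiOn_arccos ⟨by linarith, by linarith⟩
        ⟨by linarith, by linarith⟩ (by linarith))
    have hlty : upperAngleWrt (xDist X) m (fun s => σ (a + s)) τ < Real.arccos (v - δ) :=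
      hangy.trans_lt (Real.strictAntiOn_arccos ⟨by linarith, by linarith⟩
        ⟨by linarith, by linarith⟩ (by linarith))
    have hl : 0 < min (min a b) c := lt_min (lt_min ha hb) hc
    have hla : min (min a b) c ≤ a := (min_le_left _ _).trans (min_le_left _ _)
    have hlb : min (min a b) c ≤ b := (min_le_left _ _).trans (min_le_right _ _)
    have hlc : min (min a b) c ≤ c := min_le_right _ _
    have hτs : ∀ s ∈ Icc 0 (min (min a b) c), dist m (τ s) = s := fun s hs => by
      conv_lhs => rw [← hτ0, hτgeo 0 ⟨le_rfl, hc.le⟩ s ⟨hs.1, hs.2.trans hlc⟩, zero_sub, abs_neg,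
        abs_of_nonneg hs.1]
    obtain ⟨ε₁, hε₁, h₁⟩ := exists_sq_lt_of_upperAngle_lt hl (fun s hs => by
      rw [hm, hgeo _ htD _ ⟨by linarith [hs.2], by linarith [hs.1, htD.2]⟩]
      simp [abs_of_nonneg hs.1]) hτs hltx
    obtain ⟨ε₂, hε₂, h₂⟩ := exists_sq_lt_of_upperAngle_lt hl (fun s hs => by
      rw [hm, hgeo _ htD _ ⟨by linarith [hs.1, htD.1], by linarith [hs.2]⟩]
      simp [abs_of_nonneg hs.1]) hτs hlty
    obtain ⟨s, hs, hsε⟩ := exists_between (lt_min (lt_min hε₁ hε₂) hl)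
    simp only [lt_min_iff] at hsε
    have hδ1 : δ < 1 := by linarith
    have hw : 0 < δ * s := mul_pos hδ hs
    have hws : δ * s ≤ s := by nlinarith
    have e1 := h₁ s (δ * s) hs hsε.1.1 hw (hws.trans_lt hsε.1.1)
    have e2 := h₂ s (δ * s) hs hsε.1.2 hw (hws.trans_lt hsε.1.2)
    have e3 : dist (σ (a - s)) (σ (a + s)) = 2 * s := by
      rw [hgeo _ ⟨by linarith [hsε.2.1.1], by linarith⟩ _ ⟨by linarith, by linarith [hsε.2.1.2]⟩,
        abs_sub_comm, show a + s - (a - s) = 2 * s by ring, abs_of_pos (by linarith)]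
    have e4 := dist_triangle_right (σ (a - s)) (σ (a + s)) (τ (δ * s))
    rw [e3] at e4
    exact not_two_mul_le_add_of_sq_lt hs hδ (by linarith) e1 e2 e4
  have hfin : u * (2 * a * c) * b + v * (2 * b * c) * a ≤ 0 := by
    have : u * (2 * a * c) * b + v * (2 * b * c) * a = 2 * a * b * c * (u + v) := by ring
    rw [this]
    exact mul_nonpos_of_nonneg_of_nonpos (by positivity) huv
  rw [hu', hv'] at hfin
  have : D * (c ^ 2) ≤
      D * ((1 - t) * dist z x ^ 2 + t * dist z y ^ 2 - t * (1 - t) * D ^ 2) := by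
    have h1 : D * (t * (1 - t) * D ^ 2) = (a + b) * a * b / D * D := by
      rw [hab]; field_simp; rw [ha_def, hb_def]; ring
    have h2 : (a + b) * a * b / D * D = a ^ 2 * b + b ^ 2 * a := by field_simp
    have h3 : D * c ^ 2 = a * c ^ 2 + b * c ^ 2 := by rw [← hab]; ring
    have h4 : D * ((1 - t) * dist z x ^ 2 + t * dist z y ^ 2 - t * (1 - t) * D ^ 2) =
      b * dist z x ^ 2 + a * dist z y ^ 2 - D * (t * (1 - t) * D ^ 2) := by
        rw [ha_def, hb_def]; ring
    rw [h4, h1, h2, h3]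
    linarith
  exact le_of_mul_le_mul_left this hDpos

lemma IsCATSpace.hasStewartPoints {κ : ℝ} (hκ : κ ≤ 0) {X : Type*} [MetricSpace X]
    (hX : IsCATSpace κ X) : HasStewartPoints X := by
  intro a b t ht
  obtain ⟨σ, hσ⟩ := hX.1 a trivial b trivial
  exact ⟨_, hX.stewart_of_geodesic hκ hσ ht⟩

lemma IsCATSpace.stewartConvex {κ : ℝ} (hκ : κ ≤ 0) {X : Type*} [MetricSpace X]
    (hX : IsCATSpace κ X) {C : Set X} (hC : ConvexWrt (xDist X) C) : StewartConvex C := by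
  intro a ha b hb t ht m hm
  obtain ⟨σ, hσ⟩ := hX.1 a trivial b trivial
  have h := hm.dist_le_mul ht (hX.stewart_of_geodesic hκ hσ ht)
  rw [dist_self, mul_zero] at h
  rw [dist_le_zero.1 h]
  refine hC a ha b hb (mem_iUnion₂.2 ⟨σ, hσ, _, ⟨?_, ?_⟩, rfl⟩)
  · exact mul_nonneg ht.1 dist_nonneg
  · exact mul_le_of_le_one_left dist_nonneg ht.2

/-! ### Passing to the completion -/

section Completion

variable {X Z : Type*} [MetricSpace X] [MetricSpace Z] {ι : X → Z}

lemma IsStewartPoint.map_isometry (hι : Isometry ι) (hd : DenseRange ι) {a b m : X} {t : ℝ}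
    (h : IsStewartPoint a b t m) : IsStewartPoint (ι a) (ι b) t (ι m) := by
  intro z
  refine hd.induction_on z ?_ ?_
  · exact isClosed_le (by fun_prop) (by fun_prop)
  · intro x
    simpa only [hι.dist_eq] using h x

lemma IsStewartPoint.dist_le_add {a a' b b' p q : Z} {t : ℝ} (ht : t ∈ Icc (0 : ℝ) 1)
    (hZ : HasStewartPoints Z) (hp : IsStewartPoint a b t p) (hq : IsStewartPoint a' b' t q) :
    dist p q ≤ dist a a' + dist b b' := by
  obtain ⟨r, hr⟩ := hZ a b' t ht
  have ht' : 1 - t ∈ Icc (0 : ℝ) 1 := ⟨by linarith [ht.2], by linarith [ht.1]⟩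
  have h1 := hp.dist_le_mul ht hr
  have h2 := hr.symm.dist_le_mul ht' hq.symm
  have h3 : t * dist b b' ≤ dist b b' := mul_le_of_le_one_left dist_nonneg ht.2
  have h4 : (1 - t) * dist a a' ≤ dist a a' := mul_le_of_le_one_left dist_nonneg ht'.2
  linarith [dist_triangle p r q]

lemma exists_isStewartPoint_tendsto [CompleteSpace Z] (hι : Isometry ι) (hd : DenseRange ι)
    (hX : HasStewartPoints X) {u v m : ℕ → X} {a b : Z} {t : ℝ} (ht : t ∈ Icc (0 : ℝ) 1)
    (hu : Tendsto (fun n => ι (u n)) atTop (nhds a)) (hv : Tendsto (fun n => ι (v n)) atTop (nhds b))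
    (hm : ∀ n, IsStewartPoint (u n) (v n) t (m n)) :
    ∃ p, IsStewartPoint a b t p ∧ Tendsto (fun n => ι (m n)) atTop (nhds p) := by
  have hcau : CauchySeq (fun n => ι (m n)) := by
    have hu' := hu.cauchySeq
    have hv' := hv.cauchySeq
    rw [Metric.cauchySeq_iff] at hu' hv' ⊢
    intro ε hε
    obtain ⟨N₁, h₁⟩ := hu' (ε / 2) (half_pos hε)
    obtain ⟨N₂, h₂⟩ := hv' (ε / 2) (half_pos hε)
    refine ⟨max N₁ N₂, fun k hk l hl => ?_⟩
    have e1 := h₁ k ((le_max_left _ _).trans hk) l ((le_max_left _ _).trans hl)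
    have e2 := h₂ k ((le_max_right _ _).trans hk) l ((le_max_right _ _).trans hl)
    rw [hι.dist_eq] at e1 e2 ⊢
    linarith [(hm k).dist_le_add ht hX (hm l)]
  obtain ⟨p, hp⟩ := cauchySeq_tendsto_of_complete hcau
  refine ⟨p, fun z => ?_, hp⟩
  have h := fun n => (hm n).map_isometry hι hd z
  refine le_of_tendsto_of_tendsto' ((tendsto_const_nhds.dist hp).pow 2) ?_ h
  exact ((((tendsto_const_nhds.dist hu).pow 2).const_mul _).add
    (((tendsto_const_nhds.dist hv).pow 2).const_mul _)).sub (((hu.dist hv).pow 2).const_mul _)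

lemma HasStewartPoints.of_dense [CompleteSpace Z] (hι : Isometry ι) (hd : DenseRange ι)
    (hX : HasStewartPoints X) : HasStewartPoints Z := by
  intro a b t ht
  obtain ⟨u', hu', hu⟩ := mem_closure_iff_seq_limit.1 (hd a)
  obtain ⟨v', hv', hv⟩ := mem_closure_iff_seq_limit.1 (hd b)
  choose u hu' using hu'
  choose v hv' using hv'
  choose m hm using fun n => hX (u n) (v n) t ht
  obtain ⟨p, hp, -⟩ := exists_isStewartPoint_tendsto hι hd hX ht (by simpa only [hu'] using hu)
    (by simpa only [hv'] using hv) hm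
  exact ⟨p, hp⟩

lemma StewartConvex.closure_image [CompleteSpace Z] (hι : Isometry ι) (hd : DenseRange ι)
    (hX : HasStewartPoints X) {C : Set X} (hC : StewartConvex C) :
    StewartConvex (closure (ι '' C)) := by
  intro a ha b hb t ht p hp
  obtain ⟨u', hu', hu⟩ := mem_closure_iff_seq_limit.1 ha
  obtain ⟨v', hv', hv⟩ := mem_closure_iff_seq_limit.1 hb
  choose u huC hu' using hu'
  choose v hvC hv' using hv'
  choose m hm using fun n => hX (u n) (v n) t ht
  obtain ⟨q, hq, hmq⟩ := exists_isStewartPoint_tendsto hι hd hX ht (by simpa only [hu'] using hu)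
    (by simpa only [hv'] using hv) hm
  have h := hp.dist_le_mul ht hq
  rw [dist_self, mul_zero] at h
  rw [dist_le_zero.1 h]
  exact mem_closure_of_tendsto hmq (Eventually.of_forall fun n =>
    mem_image_of_mem ι (hC _ (huC n) _ (hvC n) t ht _ (hm n)))

end Completion

/-! ### Compactness of polygonal cells -/

section Cells

lemma isCompact_convexHullWrt {V : Type*} [AddCommGroup V] [Module ℝ V] [TopologicalSpace V]
    [IsTopologicalAddGroup V] [ContinuousSMul ℝ V] {d : ℝ × ℝ → ℝ × ℝ → ℝ} {k : ℝ × ℝ → V}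
    {j : V → ℝ × ℝ} {R : Set V} (hR : Convex ℝ R) (hkR : ∀ u, k u ∈ R)
    (hjk : ∀ u, j (k u) = u) (hkj : ∀ p ∈ R, k (j p) = p) (hj : ContinuousOn j R)
    (hseg : ∀ u v w, w ∈ geodSeg d univ u v ↔ k w ∈ segment ℝ (k u) (k v))
    (F : Finset (ℝ × ℝ)) : IsCompact (convexHullWrt d (F : Set (ℝ × ℝ))) := by
  have hsub : convexHull ℝ (k '' F) ⊆ R := convexHull_min (by rintro _ ⟨u, -, rfl⟩; exact hkR u) hR
  have heq : convexHullWrt d (F : Set (ℝ × ℝ)) = j '' convexHull ℝ (k '' F) := by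
    apply Subset.antisymm
    · refine sInter_subset_of_mem ⟨?_, fun u hu =>
        ⟨k u, subset_convexHull ℝ _ (mem_image_of_mem k hu), hjk u⟩⟩
      rintro _ ⟨p, hp, rfl⟩ _ ⟨q, hq, rfl⟩ w hw
      rw [hseg, hkj p (hsub hp), hkj q (hsub hq)] at hw
      exact ⟨k w, (convex_convexHull ℝ _).segment_subset hp hq hw, hjk w⟩
    · rintro _ ⟨p, hp, rfl⟩ C ⟨hC, hFC⟩
      have hconv : Convex ℝ (k '' C) := by
        rw [convex_iff_segment_subset]
        rintro _ ⟨u, hu, rfl⟩ _ ⟨v, hv, rfl⟩ q hq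
        have hqR : q ∈ R := hR.segment_subset (hkR u) (hkR v) hq
        refine ⟨j q, hC u hu v hv ?_, hkj q hqR⟩
        rwa [hseg, hkj q hqR]
      obtain ⟨w, hw, rfl⟩ := convexHull_min (image_mono hFC) hconv hp
      rwa [hjk]
  rw [heq]
  exact ((F.finite_toSet.image k).isCompact_convexHull ℝ).image_of_continuousOn (hj.mono hsub)

lemma mem_geodSeg_mDist_zero_iff (u v w : ℝ × ℝ) :
    w ∈ geodSeg (mDist 0) univ u v ↔ Complex.equivRealProdCLM.symm w ∈
      segment ℝ (Complex.equivRealProdCLM.symm u) (Complex.equivRealProdCLM.symm v) := by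
  set k := Complex.equivRealProdCLM.symm with hk
  have hd : ∀ u v, mDist 0 u v = dist (k u) (k v) := by
    intro u v
    rw [Complex.dist_eq_re_im]
    simp [mDist, hk]
  constructor
  · intro hw
    obtain ⟨f, ⟨hf0, hf1, ⟨hD, hf⟩, -⟩, s, hs, rfl⟩ := mem_iUnion₂.1 hw
    rw [mem_segment_iff_wbtw, ← dist_add_dist_eq_iff, ← hd, ← hd, ← hd]
    have h1 := hf 0 ⟨le_rfl, hD⟩ s hs
    have h2 := hf s hs _ ⟨hD, le_rfl⟩
    rw [hf0, zero_sub, abs_neg, abs_of_nonneg hs.1] at h1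
    rw [hf1, abs_sub_comm, abs_of_nonneg (sub_nonneg.2 hs.2)] at h2
    rw [h1, h2]; ring
  · rw [segment_eq_image_lineMap]
    rintro ⟨t, ht, hw⟩
    have hD : 0 ≤ mDist 0 u v := by rw [hd]; exact dist_nonneg
    rcases hD.eq_or_lt with hD0 | hD0
    · have huv : k u = k v := by rw [← dist_eq_zero, ← hd]; exact hD0.symm
      rw [huv, AffineMap.lineMap_same_apply] at hw
      have huv := k.injective huv
      have hw := k.injective hw
      subst huv hw
      refine mem_iUnion₂.2 ⟨fun _ => u, ⟨rfl, rfl, ⟨hD, fun s hs t ht => ?_⟩, fun _ _ => trivial⟩,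
        0, ⟨le_rfl, hD⟩, rfl⟩
      rw [← hD0, Icc_self] at hs ht
      rw [← hD0, hs, ht]; simp
    · refine mem_iUnion₂.2 ⟨fun s => k.symm (AffineMap.lineMap (k u) (k v) (s / mDist 0 u v)),
        ⟨by simp, by simp [hD0.ne'], ⟨hD, fun s hs t ht => ?_⟩, fun _ _ => trivial⟩,
        t * mDist 0 u v, ⟨mul_nonneg ht.1 hD, mul_le_of_le_one_left hD ht.2⟩, ?_⟩
      · rw [hd, k.apply_symm_apply, k.apply_symm_apply, dist_lineMap_lineMap, ← hd, Real.dist_eq,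
          ← sub_div, abs_div, abs_of_pos hD0, div_mul_cancel₀ _ hD0.ne']
      · simp only [mul_div_cancel_right₀ _ hD0.ne']
        rw [hw, k.symm_apply_apply]

end Cells

/-! ### The hyperboloid model -/

section Hyperboloid

/-- The time coordinate of the point of the hyperboloid above `u`. -/
noncomputable def hypTime (u : ℝ × ℝ) : ℝ := √(1 + u.1 ^ 2 + u.2 ^ 2)

/-- The Lorentzian product of the points of the hyperboloid above `u` and `v`. -/
noncomputable def hypForm (u v : ℝ × ℝ) : ℝ := hypTime u * hypTime v - u.1 * v.1 - u.2 * v.2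

lemma mDist_of_ne_zero {κ : ℝ} (hκ : κ ≠ 0) (u v : ℝ × ℝ) :
    mDist κ u v = 1 / √(-κ) * Real.arcosh (hypForm u v) := by
  simp only [mDist, if_neg hκ]
  rfl

lemma hypTime_pos (u : ℝ × ℝ) : 0 < hypTime u := Real.sqrt_pos.2 (by positivity)

lemma hypTime_sq (u : ℝ × ℝ) : hypTime u ^ 2 = 1 + u.1 ^ 2 + u.2 ^ 2 :=
  Real.sq_sqrt (by positivity)

lemma hypForm_self (u : ℝ × ℝ) : hypForm u u = 1 := by
  unfold hypForm
  linarith [hypTime_sq u, sq (hypTime u), sq u.1, sq u.2]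

lemma hypTime_mul_sq (u v : ℝ × ℝ) : (hypTime u * hypTime v) ^ 2 =
    (1 + u.1 * v.1 + u.2 * v.2) ^ 2 + (u.1 - v.1) ^ 2 + (u.2 - v.2) ^ 2
      + (u.1 * v.2 - u.2 * v.1) ^ 2 := by
  rw [mul_pow, hypTime_sq, hypTime_sq]; ring

lemma one_le_hypForm (u v : ℝ × ℝ) : 1 ≤ hypForm u v := by
  have h := hypTime_mul_sq u v
  have h1 : (1 + u.1 * v.1 + u.2 * v.2) ^ 2 ≤ (hypTime u * hypTime v) ^ 2 := by
    rw [h]; nlinarith [sq_nonneg (u.1 - v.1), sq_nonneg (u.2 - v.2),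
      sq_nonneg (u.1 * v.2 - u.2 * v.1)]
  have := abs_le_of_sq_le_sq' h1 (mul_pos (hypTime_pos u) (hypTime_pos v)).le
  unfold hypForm
  linarith [this.2]

lemma eq_of_hypForm_eq_one {u v : ℝ × ℝ} (h : hypForm u v = 1) : u = v := by
  have h1 := hypTime_mul_sq u v
  have h2 : hypTime u * hypTime v = 1 + u.1 * v.1 + u.2 * v.2 := by
    unfold hypForm at h; linarith
  rw [h2] at h1
  have h3 : (u.1 - v.1) ^ 2 = 0 := by
    nlinarith [sq_nonneg (u.1 - v.1), sq_nonneg (u.2 - v.2), sq_nonneg (u.1 * v.2 - u.2 * v.1)]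
  have h4 : (u.2 - v.2) ^ 2 = 0 := by
    nlinarith [sq_nonneg (u.1 - v.1), sq_nonneg (u.2 - v.2), sq_nonneg (u.1 * v.2 - u.2 * v.1)]
  exact Prod.ext (sub_eq_zero.1 (pow_eq_zero_iff two_ne_zero |>.1 h3))
    (sub_eq_zero.1 (pow_eq_zero_iff two_ne_zero |>.1 h4))

lemma eq_zero_of_null_of_orthogonal {n₀ n₁ n₂ : ℝ} (w : ℝ × ℝ)
    (hnull : n₀ ^ 2 - n₁ ^ 2 - n₂ ^ 2 = 0)
    (horth : n₀ * hypTime w - n₁ * w.1 - n₂ * w.2 = 0) : n₀ = 0 ∧ n₁ = 0 ∧ n₂ = 0 := by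
  have h1 : n₀ ^ 2 * hypTime w ^ 2 = (n₁ * w.1 + n₂ * w.2) ^ 2 := by
    rw [← mul_pow]; congr 1; linarith
  rw [hypTime_sq] at h1
  have h0 : n₀ ^ 2 = 0 := by
    have : n₀ ^ 2 + (n₁ * w.2 - n₂ * w.1) ^ 2 = 0 := by
      have e : n₀ ^ 2 = n₁ ^ 2 + n₂ ^ 2 := by linarith
      rw [e] at h1 ⊢
      linarith
    nlinarith [sq_nonneg n₀, sq_nonneg (n₁ * w.2 - n₂ * w.1)]
  have h2 : n₁ ^ 2 = 0 := by nlinarith [sq_nonneg n₁, sq_nonneg n₂]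
  have h3 : n₂ ^ 2 = 0 := by nlinarith [sq_nonneg n₁, sq_nonneg n₂]
  exact ⟨pow_eq_zero_iff two_ne_zero |>.1 h0, pow_eq_zero_iff two_ne_zero |>.1 h2,
    pow_eq_zero_iff two_ne_zero |>.1 h3⟩

lemma sinh_mul_eq_of_hypForm {u v w : ℝ × ℝ} {p q : ℝ} (huw : hypForm u w = Real.cosh p)
    (hwv : hypForm w v = Real.cosh q) (huv : hypForm u v = Real.cosh (p + q)) :
    Real.sinh (p + q) * hypTime w = Real.sinh q * hypTime u + Real.sinh p * hypTime v ∧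
    Real.sinh (p + q) * w.1 = Real.sinh q * u.1 + Real.sinh p * v.1 ∧
    Real.sinh (p + q) * w.2 = Real.sinh q * u.2 + Real.sinh p * v.2 := by
  have hu := hypForm_self u
  have hv := hypForm_self v
  have hw := hypForm_self w
  unfold hypForm at *
  have hp := Real.cosh_sq p
  have hq := Real.cosh_sq q
  have hc := Real.cosh_add p q
  have hs := Real.sinh_add p q
  set a := Real.sinh q
  set b := Real.sinh p
  set c := Real.sinh (p + q)
  set u₀ := hypTime u
  set v₀ := hypTime v
  obtain ⟨h0, h1, h2⟩ := eq_zero_of_null_of_orthogonal (n₀ := c * hypTime w - a * u₀ - b * v₀)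
    (n₁ := c * w.1 - a * u.1 - b * v.1) (n₂ := c * w.2 - a * u.2 - b * v.2) w
    (by linear_combination c ^ 2 * hw + a ^ 2 * hu + b ^ 2 * hv - 2 * c * a * huw - 2 * c * b * hwv
          + 2 * a * b * huv + (c - b * Real.cosh q - a * Real.cosh p) * hs + 2 * a * b * hc
          - a ^ 2 * hp - b ^ 2 * hq)
    (by linear_combination c * hw - a * huw - b * hwv + hs)
  exact ⟨by linarith, by linarith, by linarith⟩

/-- The projection of the hyperboloid to the Klein disc. -/
noncomputable def klein (u : ℝ × ℝ) : ℝ × ℝ := (u.1 / hypTime u, u.2 / hypTime u)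

lemma klein_mem_segment {u v w : ℝ × ℝ} {a b c : ℝ} (ha : 0 ≤ a) (hb : 0 ≤ b) (hc : 0 < c)
    (h0 : c * hypTime w = a * hypTime u + b * hypTime v)
    (h1 : c * w.1 = a * u.1 + b * v.1) (h2 : c * w.2 = a * u.2 + b * v.2) :
    klein w ∈ segment ℝ (klein u) (klein v) := by
  have hu := hypTime_pos u
  have hv := hypTime_pos v
  have hw := hypTime_pos w
  have hcw : 0 < c * hypTime w := mul_pos hc hw
  refine ⟨a * hypTime u / (c * hypTime w), b * hypTime v / (c * hypTime w), by positivity,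
    by positivity, ?_, ?_⟩
  · rw [← add_div, ← h0, div_self hcw.ne']
  · ext
    · simp only [klein, Prod.smul_mk, Prod.mk_add_mk, smul_eq_mul]
      field_simp
      linarith
    · simp only [klein, Prod.smul_mk, Prod.mk_add_mk, smul_eq_mul]
      field_simp
      linarith

lemma exists_of_klein_mem_segment {u v w : ℝ × ℝ} (h : klein w ∈ segment ℝ (klein u) (klein v)) :
    ∃ a b : ℝ, 0 ≤ a ∧ 0 ≤ b ∧ hypTime w = a * hypTime u + b * hypTime v ∧
      w.1 = a * u.1 + b * v.1 ∧ w.2 = a * u.2 + b * v.2 := by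
  obtain ⟨r, s, hr, hs, hrs, h⟩ := h
  have hu := hypTime_pos u
  have hv := hypTime_pos v
  have hw := hypTime_pos w
  simp only [klein, Prod.smul_mk, Prod.mk_add_mk, smul_eq_mul, Prod.mk.injEq] at h
  refine ⟨r * hypTime w / hypTime u, s * hypTime w / hypTime v, by positivity, by positivity,
    ?_, ?_, ?_⟩
  · field_simp
    linarith
  · have := h.1
    rw [eq_div_iff hw.ne'] at this
    rw [← this]; ring
  · have := h.2
    rw [eq_div_iff hw.ne'] at this
    rw [← this]; ring

lemma hypTime_eq_of_sq {u : ℝ × ℝ} {r : ℝ} (hr : 0 ≤ r) (h : r ^ 2 = 1 + u.1 ^ 2 + u.2 ^ 2) :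
    hypTime u = r := by
  rw [hypTime, ← h, Real.sqrt_sq hr]

/-- The unit-speed geodesic of the hyperboloid from `u` to `v`, at distance `D`. -/
noncomputable def hypGeodesic (u v : ℝ × ℝ) (D s : ℝ) : ℝ × ℝ :=
  ((Real.sinh (D - s) * u.1 + Real.sinh s * v.1) / Real.sinh D,
    (Real.sinh (D - s) * u.2 + Real.sinh s * v.2) / Real.sinh D)

lemma hypTime_hypGeodesic {u v : ℝ × ℝ} {D s : ℝ} (hD : 0 < D) (hs : s ∈ Icc 0 D)
    (huv : hypForm u v = Real.cosh D) :
    hypTime (hypGeodesic u v D s) =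
      (Real.sinh (D - s) * hypTime u + Real.sinh s * hypTime v) / Real.sinh D := by
  have hsD := Real.sinh_pos_iff.2 hD
  have h1 := Real.sinh_nonneg_iff.2 hs.1
  have h2 := Real.sinh_nonneg_iff.2 (sub_nonneg.2 hs.2)
  apply hypTime_eq_of_sq
  · have := (hypTime_pos u).le
    have := (hypTime_pos v).le
    positivity
  · simp only [hypGeodesic]
    have hu := hypForm_self u
    have hv := hypForm_self v
    unfold hypForm at hu hv huv
    have hcs := Real.cosh_sq s
    have hcD := Real.cosh_sq D
    have hsub := Real.sinh_sub D s
    field_simp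
    set a := Real.sinh (D - s)
    set b := Real.sinh s
    set c := Real.sinh D
    linear_combination a ^ 2 * hu + b ^ 2 * hv + 2 * a * b * huv
      + (a + c * Real.cosh s + Real.cosh D * b) * hsub + c ^ 2 * hcs - b ^ 2 * hcD

lemma hypForm_hypGeodesic {u v : ℝ × ℝ} {D s t : ℝ} (hD : 0 < D) (hs : s ∈ Icc 0 D)
    (ht : t ∈ Icc 0 D) (huv : hypForm u v = Real.cosh D) :
    hypForm (hypGeodesic u v D s) (hypGeodesic u v D t) = Real.cosh (s - t) := by
  have hsD := Real.sinh_pos_iff.2 hD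
  have hu := hypForm_self u
  have hv := hypForm_self v
  unfold hypForm at hu hv huv ⊢
  rw [hypTime_hypGeodesic hD hs huv, hypTime_hypGeodesic hD ht huv]
  simp only [hypGeodesic]
  have hcs := Real.cosh_sq s
  have hcD := Real.cosh_sq D
  have hsub := Real.sinh_sub D s
  have hsub' := Real.sinh_sub D t
  rw [Real.cosh_sub]
  field_simp
  rw [hsub, hsub']
  set a := Real.sinh s
  set a' := Real.sinh t
  set c := Real.sinh D
  set d := Real.cosh D
  set e := Real.cosh s
  set e' := Real.cosh t
  linear_combination (c * e - d * a) * (c * e' - d * a') * hu + a * a' * hv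
    + ((c * e - d * a) * a' + (c * e' - d * a') * a) * huv - a * a' * hcD

end Hyperboloid

section ModelPlane

lemma hypForm_eq_cosh_mDist {κ : ℝ} (hκ : κ < 0) (u v : ℝ × ℝ) :
    hypForm u v = Real.cosh (√(-κ) * mDist κ u v) := by
  have hk : 0 < √(-κ) := Real.sqrt_pos.2 (by linarith)
  rw [mDist_of_ne_zero hκ.ne, ← mul_assoc, mul_one_div_cancel hk.ne', one_mul,
    Real.cosh_arcosh (one_le_hypForm u v)]

lemma mDist_nonneg (κ : ℝ) (u v : ℝ × ℝ) : 0 ≤ mDist κ u v := by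
  rcases eq_or_ne κ 0 with rfl | hκ
  · simp only [mDist, if_true]
    exact Real.sqrt_nonneg _
  · rw [mDist_of_ne_zero hκ]
    have := Real.arcosh_nonneg (one_le_hypForm u v)
    positivity

lemma mDist_hypGeodesic {κ : ℝ} (hκ : κ < 0) {u v : ℝ × ℝ} {D s t : ℝ} (hD : 0 < D)
    (hs : s ∈ Icc 0 D) (ht : t ∈ Icc 0 D) (huv : hypForm u v = Real.cosh D) :
    mDist κ (hypGeodesic u v D s) (hypGeodesic u v D t) = 1 / √(-κ) * |s - t| := by
  rw [mDist_of_ne_zero hκ.ne, hypForm_hypGeodesic hD hs ht huv, ← Real.cosh_abs,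
    Real.arcosh_cosh (abs_nonneg _)]

lemma exists_hypGeodesic_eq {u v w : ℝ × ℝ} {D : ℝ} (hD : 0 < D)
    (huv : hypForm u v = Real.cosh D) (h : klein w ∈ segment ℝ (klein u) (klein v)) :
    ∃ s ∈ Icc 0 D, hypGeodesic u v D s = w := by
  obtain ⟨a, b, ha, hb, h0, h1, h2⟩ := exists_of_klein_mem_segment h
  have hsD := Real.sinh_pos_iff.2 hD
  have hcD := Real.cosh_pos D
  have hquad : a ^ 2 + b ^ 2 + 2 * a * b * Real.cosh D = 1 := by
    have hu := hypForm_self u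
    have hv := hypForm_self v
    have hw := hypForm_self w
    unfold hypForm at hu hv hw huv
    rw [h0, h1, h2] at hw
    linear_combination hw - a ^ 2 * hu - b ^ 2 * hv - 2 * a * b * huv
  have hb1 : b ≤ 1 := by
    have : 0 ≤ 2 * a * b * Real.cosh D := by positivity
    nlinarith [sq_nonneg a]
  set s := Real.arsinh (b * Real.sinh D) with hs_def
  have hs : Real.sinh s = b * Real.sinh D := Real.sinh_arsinh _
  have hsmem : s ∈ Icc 0 D := by
    constructor
    · rw [← Real.sinh_nonneg_iff, hs]; positivity
    · rw [← Real.sinh_le_sinh, hs]; exact mul_le_of_le_one_left hsD.le hb1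
  have hDs : Real.sinh (D - s) = a * Real.sinh D := by
    have hnn := Real.sinh_nonneg_iff.2 (sub_nonneg.2 hsmem.2)
    have hsub := Real.sinh_sub D s
    have hcs := Real.cosh_sq s
    have hc2 := Real.cosh_sq D
    rw [hs] at hsub hcs
    set x := Real.sinh (D - s)
    set c := Real.sinh D
    set d := Real.cosh D
    have hx : x ^ 2 + 2 * x * (d * (b * c)) + (b * c) ^ 2 = c ^ 2 := by
      linear_combination (x + c * Real.cosh s + d * (b * c)) * hsub + c ^ 2 * hcs
        - (b * c) ^ 2 * hc2
    have hprod : (x - a * c) * (x + a * c + 2 * (d * (b * c))) = 0 := by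
      linear_combination hx - c ^ 2 * hquad
    rcases mul_eq_zero.1 hprod with h' | h'
    · linarith
    · have e1 : 0 ≤ a * c := by positivity
      have e2 : 0 ≤ 2 * (d * (b * c)) := by positivity
      linarith
  refine ⟨s, hsmem, ?_⟩
  unfold hypGeodesic
  rw [hs, hDs]
  ext
  · simp only [h1]; field_simp
  · simp only [h2]; field_simp

lemma hypGeodesic_zero (u v : ℝ × ℝ) {D : ℝ} (hD : 0 < D) : hypGeodesic u v D 0 = u := by
  have hsD := Real.sinh_pos_iff.2 hD
  ext <;> simp [hypGeodesic, hsD.ne', mul_div_cancel_left₀]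

lemma hypGeodesic_self (u v : ℝ × ℝ) {D : ℝ} (hD : 0 < D) : hypGeodesic u v D D = v := by
  have hsD := Real.sinh_pos_iff.2 hD
  ext <;> simp [hypGeodesic, hsD.ne', mul_div_cancel_left₀]

lemma mem_geodSeg_mDist_iff {κ : ℝ} (hκ : κ < 0) (u v w : ℝ × ℝ) :
    w ∈ geodSeg (mDist κ) univ u v ↔ klein w ∈ segment ℝ (klein u) (klein v) := by
  have hk : 0 < √(-κ) := Real.sqrt_pos.2 (by linarith)
  have hD := mDist_nonneg κ u v
  constructor
  · intro hw
    obtain ⟨f, ⟨hf0, hf1, ⟨-, hf⟩, -⟩, s, hs, rfl⟩ := mem_iUnion₂.1 hw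
    have h1 := hf 0 ⟨le_rfl, hD⟩ s hs
    have h2 := hf s hs _ ⟨hD, le_rfl⟩
    rw [hf0, zero_sub, abs_neg, abs_of_nonneg hs.1] at h1
    rw [hf1, abs_sub_comm, abs_of_nonneg (sub_nonneg.2 hs.2)] at h2
    rcases hD.eq_or_lt with hD0 | hD0
    · have hs0 : s = 0 := le_antisymm (hD0 ▸ hs.2) hs.1
      rw [hs0, hf0]
      exact left_mem_segment ℝ _ _
    · have e1 := hypForm_eq_cosh_mDist hκ u (f s)
      have e2 := hypForm_eq_cosh_mDist hκ (f s) v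
      have e3 := hypForm_eq_cosh_mDist hκ u v
      rw [h1] at e1
      rw [h2] at e2
      have hsum : √(-κ) * s + √(-κ) * (mDist κ u v - s) = √(-κ) * mDist κ u v := by ring
      obtain ⟨k0, k1, k2⟩ := sinh_mul_eq_of_hypForm e1 e2 (by rw [hsum]; exact e3)
      rw [hsum] at k0 k1 k2
      exact klein_mem_segment (Real.sinh_nonneg_iff.2 (mul_nonneg hk.le (sub_nonneg.2 hs.2)))
        (Real.sinh_nonneg_iff.2 (mul_nonneg hk.le hs.1)) (Real.sinh_pos_iff.2 (mul_pos hk hD0))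
        k0 k1 k2
  · intro hw
    have huv := hypForm_eq_cosh_mDist hκ u v
    rcases hD.eq_or_lt with hD0 | hD0
    · rw [← hD0, mul_zero, Real.cosh_zero] at huv
      have huv := eq_of_hypForm_eq_one huv
      subst huv
      have hwu : hypForm w u = 1 := by
        obtain ⟨a, b, ha, hb, h0, h1, h2⟩ := exists_of_klein_mem_segment hw
        have hu := hypForm_self u
        have hw := hypForm_self w
        unfold hypForm at hu hw ⊢
        rw [h0, h1, h2] at hw ⊢
        have hab : (a + b) ^ 2 = 1 := by linear_combination hw - (a + b) ^ 2 * hu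
        have hab : a + b = 1 := by nlinarith
        linear_combination (a + b) * hu + hab
      rw [eq_of_hypForm_eq_one hwu]
      refine mem_iUnion₂.2 ⟨fun _ => u, ⟨rfl, rfl, ⟨hD, fun s hs t ht => ?_⟩, fun _ _ => trivial⟩,
        0, ⟨le_rfl, hD⟩, rfl⟩
      rw [← hD0, Icc_self] at hs ht
      rw [← hD0, hs, ht]; simp
    · have hDk : 0 < √(-κ) * mDist κ u v := mul_pos hk hD0
      obtain ⟨s, hs, rfl⟩ := exists_hypGeodesic_eq hDk huv hw
      refine mem_iUnion₂.2 ⟨fun r => hypGeodesic u v (√(-κ) * mDist κ u v) (√(-κ) * r),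
        ⟨?_, ?_, ⟨hD, fun r hr t ht => ?_⟩, fun _ _ => trivial⟩, s / √(-κ), ⟨?_, ?_⟩, ?_⟩
      · simp [hypGeodesic_zero _ _ hDk]
      · simp [hypGeodesic_self _ _ hDk]
      · rw [mDist_hypGeodesic hκ hDk ⟨mul_nonneg hk.le hr.1, mul_le_mul_of_nonneg_left hr.2 hk.le⟩
          ⟨mul_nonneg hk.le ht.1, mul_le_mul_of_nonneg_left ht.2 hk.le⟩ huv, ← mul_sub, abs_mul,
          abs_of_pos hk, ← mul_assoc, one_div_mul_cancel hk.ne', one_mul]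
      · exact div_nonneg hs.1 hk.le
      · rw [div_le_iff₀ hk, mul_comm]; exact hs.2
      · simp only [mul_div_cancel₀ _ hk.ne']

lemma convex_disc : Convex ℝ {p : ℝ × ℝ | p.1 ^ 2 + p.2 ^ 2 < 1} := by
  intro p hp q hq a b ha hb hab
  simp only [mem_ofPred_eq, Prod.fst_add, Prod.smul_fst, Prod.snd_add, Prod.smul_snd,
    smul_eq_mul] at *
  have hb' : b = 1 - a := by linarith
  have h1 : 0 ≤ a * b * ((p.1 - q.1) ^ 2 + (p.2 - q.2) ^ 2) := by positivity
  have h2 : (a * p.1 + b * q.1) ^ 2 + (a * p.2 + b * q.2) ^ 2 =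
      a * (p.1 ^ 2 + p.2 ^ 2) + b * (q.1 ^ 2 + q.2 ^ 2)
        - a * b * ((p.1 - q.1) ^ 2 + (p.2 - q.2) ^ 2) := by
    rw [hb']; ring
  rcases ha.eq_or_lt with ha0 | ha0
  · have : b = 1 := by linarith
    rw [h2, ← ha0, this]; linarith
  · nlinarith [mul_lt_mul_of_pos_left hp ha0, mul_le_mul_of_nonneg_left hq.le hb]

lemma IsPolygonalCell.isCompact {κ : ℝ} (hκ : κ ≤ 0) {P : Set (ℝ × ℝ)}
    (hP : IsPolygonalCell κ P) : IsCompact P := by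
  obtain ⟨F, rfl, -⟩ := hP
  rcases hκ.eq_or_lt with rfl | hκ
  · exact isCompact_convexHullWrt (k := Complex.equivRealProdCLM.symm)
      (j := Complex.equivRealProdCLM) convex_univ (fun _ => trivial) (fun u => by simp)
      (fun p _ => Complex.equivRealProdCLM.symm_apply_apply p) (ContinuousLinearEquiv.continuous _).continuousOn
      mem_geodSeg_mDist_zero_iff F
  · have hdisc : ∀ p : ℝ × ℝ, p ∈ {p : ℝ × ℝ | p.1 ^ 2 + p.2 ^ 2 < 1} →
        0 < √(1 - p.1 ^ 2 - p.2 ^ 2) := fun p hp => Real.sqrt_pos.2 (by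
      rw [mem_ofPred_eq] at hp; linarith)
    refine isCompact_convexHullWrt (k := klein)
      (j := fun p => (p.1 / √(1 - p.1 ^ 2 - p.2 ^ 2), p.2 / √(1 - p.1 ^ 2 - p.2 ^ 2))) convex_disc
      (fun u => ?_) (fun u => ?_) (fun p hp => ?_) ?_ (mem_geodSeg_mDist_iff hκ) F
    · have h := hypTime_sq u
      have h' := hypTime_pos u
      simp only [klein, mem_ofPred_eq, div_pow]
      rw [← add_div, div_lt_one (by positivity)]
      linarith
    · have h := hypTime_sq u
      have h' := hypTime_pos u
      have e : √(1 - (klein u).1 ^ 2 - (klein u).2 ^ 2) = 1 / hypTime u := by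
        rw [← Real.sqrt_sq (one_div_pos.2 h').le]
        congr 1
        simp only [klein]
        field_simp
        linarith
      simp only [e]
      simp only [klein]
      ext <;> field_simp
    · have h := hdisc p hp
      have h2 : √(1 - p.1 ^ 2 - p.2 ^ 2) ^ 2 = 1 - p.1 ^ 2 - p.2 ^ 2 := Real.sq_sqrt (by
        rw [mem_ofPred_eq] at hp; linarith)
      set r := √(1 - p.1 ^ 2 - p.2 ^ 2)
      have e : hypTime (p.1 / r, p.2 / r) = 1 / r := by
        refine hypTime_eq_of_sq (one_div_pos.2 h).le ?_
        simp only
        field_simp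
        linarith
      simp only [klein, e]
      ext <;> field_simp
    · have hc : ContinuousOn (fun p : ℝ × ℝ => √(1 - p.1 ^ 2 - p.2 ^ 2))
          {p : ℝ × ℝ | p.1 ^ 2 + p.2 ^ 2 < 1} := by fun_prop
      exact (continuousOn_fst.div hc fun p hp => (hdisc p hp).ne').prodMk
        (continuousOn_snd.div hc fun p hp => (hdisc p hp).ne')

lemma one_add_sq_div_two_le_cosh (x : ℝ) : 1 + x ^ 2 / 2 ≤ Real.cosh x := by
  have h := sum_le_hasSum (Finset.range 2) (fun n _ => by rw [pow_mul]; positivity)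
    (Real.hasSum_cosh x)
  simpa [Finset.sum_range_succ] using h

/-- The model distance is dominated by the coordinate distance. -/
lemma exists_mDist_le {κ : ℝ} (hκ : κ ≤ 0) : ∃ K > 0, ∀ u v, mDist κ u v ≤ K * dist u v := by
  have hE : ∀ u v : ℝ × ℝ, (u.1 - v.1) ^ 2 + (u.2 - v.2) ^ 2 ≤ 2 * dist u v ^ 2 := by
    intro u v
    rw [Prod.dist_eq]
    have h1 := le_max_left (dist u.1 v.1) (dist u.2 v.2)
    have h2 := le_max_right (dist u.1 v.1) (dist u.2 v.2)
    set M := max (dist u.1 v.1) (dist u.2 v.2)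
    have h1' := pow_le_pow_left₀ dist_nonneg h1 2
    have h2' := pow_le_pow_left₀ dist_nonneg h2 2
    rw [Real.dist_eq, sq_abs] at h1' h2'
    linarith
  rcases hκ.eq_or_lt with rfl | hκ
  · refine ⟨2, two_pos, fun u v => ?_⟩
    simp only [mDist, if_true]
    refine Real.sqrt_le_iff.2 ⟨by positivity, ?_⟩
    nlinarith [hE u v, dist_nonneg (x := u) (y := v)]
  · have hk : 0 < √(-κ) := Real.sqrt_pos.2 (by linarith)
    refine ⟨1 / √(-κ) * 2, by positivity, fun u v => ?_⟩
    rw [mDist_of_ne_zero hκ.ne, mul_assoc]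
    refine mul_le_mul_of_nonneg_left ?_ (by positivity)
    have h1 := Real.arcosh_nonneg (one_le_hypForm u v)
    have h2 := Real.cosh_arcosh (one_le_hypForm u v)
    have h3 := one_add_sq_div_two_le_cosh (Real.arcosh (hypForm u v))
    have h4 : 2 * (hypForm u v - 1) ≤ (u.1 - v.1) ^ 2 + (u.2 - v.2) ^ 2 := by
      unfold hypForm
      nlinarith [sq_nonneg (hypTime u - hypTime v), hypTime_sq u, hypTime_sq v]
    have h5 := hE u v
    refine (abs_le_of_sq_le_sq' ?_ (by positivity)).2
    nlinarith [dist_nonneg (x := u) (y := v)]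

end ModelPlane

section Covers

variable {X : Type*} [MetricSpace X]

lemma HasQuadraticCover.mono {M N : Set X} (hN : HasQuadraticCover N) (h : M ⊆ N) :
    HasQuadraticCover M := by
  obtain ⟨A, hA⟩ := hN
  refine ⟨A, fun n => ?_⟩
  obtain ⟨P, hP, hc⟩ := hA n
  exact ⟨P, hP, fun z hz => hc z (h hz)⟩

lemma HasQuadraticCover.union {M N : Set X} (hM : HasQuadraticCover M)
    (hN : HasQuadraticCover N) : HasQuadraticCover (M ∪ N) := by
  classical
  obtain ⟨A, hA⟩ := hM
  obtain ⟨B, hB⟩ := hN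
  refine ⟨A + B, fun n => ?_⟩
  obtain ⟨P, hP, hc⟩ := hA n
  obtain ⟨Q, hQ, hd⟩ := hB n
  refine ⟨P ∪ Q, ?_, ?_⟩
  · have : ((P ∪ Q).card : ℝ) ≤ P.card + Q.card := by exact_mod_cast Finset.card_union_le P Q
    nlinarith
  · rintro z (hz | hz)
    · obtain ⟨c, hc, h⟩ := hc z hz
      exact ⟨c, Finset.mem_union_left _ hc, h⟩
    · obtain ⟨c, hc, h⟩ := hd z hz
      exact ⟨c, Finset.mem_union_right _ hc, h⟩

lemma hasQuadraticCover_of_finite {N : Set X} (hN : N.Finite) : HasQuadraticCover N := by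
  refine ⟨hN.toFinset.card, fun n => ⟨hN.toFinset, ?_, fun z hz =>
    ⟨z, hN.mem_toFinset.2 hz, by rw [dist_self]; positivity⟩⟩⟩
  have h1 : (1 : ℝ) ≤ ((n : ℝ) + 1) ^ 2 := by
    have : (0 : ℝ) ≤ n := Nat.cast_nonneg n
    nlinarith
  exact le_mul_of_one_le_right (Nat.cast_nonneg _) h1

lemma HasQuadraticCover.image_isometry {Z : Type*} [MetricSpace Z] {ι : X → Z} (hι : Isometry ι)
    {N : Set X} (hN : HasQuadraticCover N) : HasQuadraticCover (ι '' N) := by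
  classical
  obtain ⟨A, hA⟩ := hN
  refine ⟨A, fun n => ?_⟩
  obtain ⟨P, hP, hc⟩ := hA n
  refine ⟨P.image ι, le_trans (by exact_mod_cast Finset.card_image_le) hP, ?_⟩
  rintro _ ⟨z, hz, rfl⟩
  obtain ⟨c, hc, h⟩ := hc z hz
  exact ⟨ι c, Finset.mem_image_of_mem ι hc, by rwa [hι.dist_eq]⟩

lemma abs_sub_le_of_floor_eq {a b h : ℝ} (hh : 0 < h) (hab : ⌊a / h⌋ = ⌊b / h⌋) :
    |a - b| ≤ h := by
  have := Int.abs_sub_lt_one_of_floor_eq_floor hab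
  rw [← sub_div, abs_div, abs_of_pos hh, div_lt_one hh] at this
  exact this.le

lemma floor_div_mem_Icc {a h : ℝ} {m : ℕ} (hh : 0 < h) (ha : |a| ≤ m * h) :
    ⌊a / h⌋ ∈ Finset.Icc (-(m : ℤ)) m := by
  rw [abs_le] at ha
  rw [Finset.mem_Icc, Int.le_floor, ← @Int.cast_le ℝ]
  push_cast
  refine ⟨by rw [le_div_iff₀ hh]; linarith, (Int.floor_le _).trans ?_⟩
  rw [div_le_iff₀ hh]; exact ha.2

lemma hasQuadraticCover_image {S : Set (ℝ × ℝ)} {g : ℝ × ℝ → X} {K : ℝ} (hK : 0 < K)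
    (hS : IsCompact S) (hg : ∀ u ∈ S, ∀ v ∈ S, dist (g u) (g v) ≤ K * dist u v) :
    HasQuadraticCover (g '' S) := by
  classical
  rcases S.eq_empty_or_nonempty with rfl | ⟨u₀, hu₀⟩
  · rw [image_empty]; exact hasQuadraticCover_of_finite finite_empty
  obtain ⟨R, hR⟩ := hS.isBounded.subset_closedBall (0 : ℝ × ℝ)
  have hR' : ∀ u ∈ S, |u.1| ≤ R ∧ |u.2| ≤ R := by
    intro u hu
    have := hR hu
    rw [mem_closedBall_zero_iff, Prod.norm_def, max_le_iff] at this
    exact this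
  have hR0 : 0 ≤ R := (abs_nonneg _).trans (hR' u₀ hu₀).1
  obtain ⟨M, hM⟩ := exists_nat_ge (R * K)
  refine ⟨(2 * M + 1) ^ 2, fun n => ?_⟩
  have hn : (0 : ℝ) < (n : ℝ) + 1 := by positivity
  set h := 1 / (K * ((n : ℝ) + 1)) with hh_def
  have hh : 0 < h := by positivity
  let idx : ℝ × ℝ → ℤ × ℤ := fun u => (⌊u.1 / h⌋, ⌊u.2 / h⌋)
  let c : ℤ × ℤ → X := fun i => if hi : ∃ u ∈ S, idx u = i then g hi.choose else g u₀
  set m := M * (n + 1) with hm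
  set I := Finset.Icc (-(m : ℤ)) m with hI
  refine ⟨(I ×ˢ I).image c, ?_, ?_⟩
  · have h1 : (((I ×ˢ I).image c).card : ℝ) ≤ ((2 * m + 1) * (2 * m + 1) : ℕ) := by
      rw [Nat.cast_le]
      refine Finset.card_image_le.trans (le_of_eq ?_)
      have hIc : I.card = 2 * m + 1 := by
        rw [hI, Int.card_Icc]; omega
      rw [Finset.card_product, hIc]
    refine h1.trans ?_
    rw [hm]
    push_cast
    have hM0 : (0 : ℝ) ≤ M := Nat.cast_nonneg M
    have hn0 : (0 : ℝ) ≤ n := Nat.cast_nonneg n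
    have h2 : 2 * ((M : ℝ) * (n + 1)) + 1 ≤ (2 * M + 1) * (n + 1) := by nlinarith
    rw [← sq, ← mul_pow]
    exact pow_le_pow_left₀ (by positivity) h2 2
  · rintro _ ⟨u, hu, rfl⟩
    have hex : ∃ v ∈ S, idx v = idx u := ⟨u, hu, rfl⟩
    have hRm : R ≤ m * h := by
      rw [hm, hh_def]
      push_cast
      rw [mul_one_div, le_div_iff₀ (by positivity)]
      nlinarith
    refine ⟨c (idx u), Finset.mem_image_of_mem c (Finset.mem_product.2
      ⟨floor_div_mem_Icc hh ((hR' u hu).1.trans hRm),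
        floor_div_mem_Icc hh ((hR' u hu).2.trans hRm)⟩), ?_⟩
    have hc : c (idx u) = g hex.choose := dif_pos hex
    obtain ⟨hvS, hv⟩ := hex.choose_spec
    rw [hc]
    set v := hex.choose
    simp only [idx, Prod.mk.injEq] at hv
    have hd : dist u v ≤ h := by
      rw [Prod.dist_eq]
      exact max_le (abs_sub_le_of_floor_eq hh hv.1.symm) (abs_sub_le_of_floor_eq hh hv.2.symm)
    calc dist (g u) (g v) ≤ K * dist u v := hg u hu v hvS
      _ ≤ K * h := by gcongr
      _ = 1 / ((n : ℝ) + 1) := by rw [hh_def]; field_simp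

/-- Compact sets of dimension at most two, in the sense of covering numbers. -/
def IsCompactQuadratic (N : Set X) : Prop := IsCompact N ∧ HasQuadraticCover N

lemma IsCompactQuadratic.union {M N : Set X} (hM : IsCompactQuadratic M)
    (hN : IsCompactQuadratic N) : IsCompactQuadratic (M ∪ N) :=
  ⟨hM.1.union hN.1, hM.2.union hN.2⟩

lemma isCompactQuadratic_of_finite {N : Set X} (hN : N.Finite) : IsCompactQuadratic N :=
  ⟨hN.isCompact, hasQuadraticCover_of_finite hN⟩

lemma isCompactQuadratic_image {S : Set (ℝ × ℝ)} {g : ℝ × ℝ → X} {K : ℝ} (hK : 0 < K)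
    (hS : IsCompact S) (hg : ∀ u ∈ S, ∀ v ∈ S, dist (g u) (g v) ≤ K * dist u v) :
    IsCompactQuadratic (g '' S) := by
  refine ⟨hS.image_of_continuousOn ?_, hasQuadraticCover_image hK hS hg⟩
  exact (LipschitzOnWith.of_dist_le_mul (K := ⟨K, hK.le⟩) hg).continuousOn

lemma exists_isCompactQuadratic_sUnion {T : Set (Set X)} (hT : T.Finite)
    (h : ∀ c ∈ T, ∃ N, IsCompactQuadratic N ∧ c ⊆ N) :
    ∃ N, IsCompactQuadratic N ∧ ⋃₀ T ⊆ N := by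
  induction T, hT using Set.Finite.induction_on with
  | empty => exact ⟨∅, isCompactQuadratic_of_finite finite_empty, by simp⟩
  | @insert a s _ _ ih =>
    obtain ⟨N, hN, hsN⟩ := ih fun c hc => h c (mem_insert_of_mem _ hc)
    obtain ⟨M, hM, haM⟩ := h a (mem_insert _ _)
    exact ⟨M ∪ N, hM.union hN, by rw [sUnion_insert]; exact union_subset_union haM hsN⟩

lemma PolyComplex2.exists_face_subset {κ : ℝ} (hκ : κ ≤ 0) (PC : PolyComplex2 κ X) {F : Set X}
    (hF : F ∈ PC.faces) : ∃ N, IsCompactQuadratic N ∧ F ⊆ N := by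
  rcases F.eq_empty_or_nonempty with rfl | ⟨x₀, hx₀⟩
  · exact ⟨∅, isCompactQuadratic_of_finite finite_empty, subset_rfl⟩
  obtain ⟨f, P, hP, hinj, himg, -, hd⟩ := PC.face_chart F hF
  obtain ⟨K, hK, hle⟩ := exists_mDist_le hκ
  have : Nonempty X := ⟨x₀⟩
  have hleft := hinj.leftInvOn_invFunOn
  refine ⟨Function.invFunOn f (closure F) '' P, isCompactQuadratic_image hK (hP.isCompact hκ) ?_,
    fun x hx => ⟨f x, himg ▸ mem_image_of_mem f (subset_closure hx), hleft (subset_closure hx)⟩⟩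
  rw [← himg]
  rintro _ ⟨x, hx, rfl⟩ _ ⟨y, hy, rfl⟩
  rw [hleft hx, hleft hy, ← hd x hx y hy]
  exact hle _ _

lemma PolyComplex2.exists_edge_subset {κ : ℝ} (PC : PolyComplex2 κ X) {e : Set X}
    (he : e ∈ PC.edges) : ∃ N, IsCompactQuadratic N ∧ e ⊆ N := by
  obtain ⟨f, L, hL, ⟨-, hf⟩, rfl⟩ := PC.edge_geodesic e he
  refine ⟨(fun p : ℝ × ℝ => f p.1) '' (Icc 0 L ×ˢ {0}),
    isCompactQuadratic_image one_pos (isCompact_Icc.prod isCompact_singleton) ?_, ?_⟩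
  · rintro u hu v hv
    simp only at hf ⊢
    rw [hf _ hu.1 _ hv.1, one_mul, Prod.dist_eq]
    exact le_max_left _ _
  · rintro _ ⟨t, ht, rfl⟩
    exact ⟨(t, 0), ⟨Ioo_subset_Icc_self ht, rfl⟩, rfl⟩

lemma PolyComplex2.exists_ball_subset {κ : ℝ} (hκ : κ ≤ 0) (PC : PolyComplex2 κ X) (x : X) :
    ∃ ε > 0, ∃ N, IsCompactQuadratic N ∧ ball x ε ⊆ N := by
  obtain ⟨ε, hε, hcells, hverts⟩ := PC.locally_finite x
  obtain ⟨N, hN, hsub⟩ := exists_isCompactQuadratic_sUnion hcells fun c hc =>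
    hc.1.elim (PC.exists_face_subset hκ) PC.exists_edge_subset
  refine ⟨ε, hε, N ∪ PC.vertices ∩ ball x ε, hN.union (isCompactQuadratic_of_finite hverts),
    fun y hy => ?_⟩
  have hcov : y ∈ ⋃₀ PC.faces ∪ ⋃₀ PC.edges ∪ PC.vertices := PC.cover ▸ mem_univ y
  rcases hcov with (⟨c, hc, hyc⟩ | ⟨c, hc, hyc⟩) | hyv
  · exact Or.inl (hsub ⟨c, ⟨Or.inl hc, y, hyc, hy⟩, hyc⟩)
  · exact Or.inl (hsub ⟨c, ⟨Or.inr hc, y, hyc, hy⟩, hyc⟩)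
  · exact Or.inr ⟨hyv, hy⟩

lemma PolyComplex2.exists_thickening_subset {κ : ℝ} (hκ : κ ≤ 0) (PC : PolyComplex2 κ X)
    {S : Set X} (hS : IsCompact S) :
    ∃ ε > 0, ∃ N, IsCompactQuadratic N ∧ ∀ x ∈ S, ball x ε ⊆ N := by
  refine hS.induction_on (p := fun S => ∃ ε > 0, ∃ N, IsCompactQuadratic N ∧ ∀ x ∈ S, ball x ε ⊆ N)
    ?_ ?_ ?_ ?_
  · exact ⟨1, one_pos, ∅, isCompactQuadratic_of_finite finite_empty, by simp⟩
  · rintro s t hst ht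
    obtain ⟨ε, hε, N, hN, h⟩ := ht
    exact ⟨ε, hε, N, hN, fun x hx => h x (hst hx)⟩
  · rintro s t hs ht
    obtain ⟨ε, hε, N, hN, h⟩ := hs
    obtain ⟨ε', hε', N', hN', h'⟩ := ht
    refine ⟨min ε ε', lt_min hε hε', N ∪ N', hN.union hN', ?_⟩
    rintro x (hx | hx)
    · exact ((ball_subset_ball (min_le_left _ _)).trans (h x hx)).trans subset_union_left
    · exact ((ball_subset_ball (min_le_right _ _)).trans (h' x hx)).trans subset_union_right
  · rintro x -
    obtain ⟨ε, hε, N, hN, h⟩ := PC.exists_ball_subset hκ x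
    refine ⟨ball x (ε / 2), mem_nhdsWithin_of_mem_nhds (ball_mem_nhds x (half_pos hε)),
      ε / 2, half_pos hε, N, hN, fun y hy => (ball_subset_ball' ?_).trans h⟩
    rw [mem_ball] at hy
    linarith

end Covers

section PathMetric

variable {X : Type*} [MetricSpace X]

lemma RectConnected.dist_le_pathDistIn {E : Set X} (hE : RectConnected E) {x y : X} (hx : x ∈ E)
    (hy : y ∈ E) : dist x y ≤ pathDistIn E x y := by
  obtain ⟨g, hg, hgv⟩ := hE x hx y hy
  unfold pathDistIn
  rw [dist_edist]
  refine ENNReal.toReal_mono (ne_top_of_le_ne_top hgv (iInf_le_of_le ⟨g, hg⟩ le_rfl)) ?_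
  refine le_iInf fun h => ?_
  have := eVariationOn.edist_le h.1 (s := Icc 0 1) ⟨le_rfl, zero_le_one⟩ ⟨zero_le_one, le_rfl⟩
  rwa [h.2.2.1, h.2.2.2.1] at this

lemma pathDistIn_le_of_lipschitz {E : Set X} {c : ℝ → X} {T : ℝ} (hc : LipschitzWith 1 c)
    (hcE : ∀ t, c t ∈ E) (hT : 0 ≤ T) : pathDistIn E (c 0) (c T) ≤ T := by
  have hpath : IsPathIn E (fun t => c (T * t)) (c 0) (c T) :=
    ⟨(hc.continuous.comp (continuous_const.mul continuous_id)).continuousOn, by simp, by simp,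
      fun t _ => hcE _⟩
  have hvar : eVariationOn (fun t => c (T * t)) (Icc 0 1) ≤ ENNReal.ofReal T := by
    have h1 := (hc.lipschitzOnWith (s := univ)).comp_eVariationOn_le
      (f := c) (g := fun t => T * t) (s := Icc 0 1) (fun _ _ => trivial)
    have hmono : MonotoneOn (fun t => T * t) (Icc (0 : ℝ) 1) := fun a _ b _ hab =>
      mul_le_mul_of_nonneg_left hab hT
    have h2 := hmono.eVariationOn_eq (a := 0) (b := 1) ⟨le_rfl, zero_le_one⟩ ⟨zero_le_one, le_rfl⟩
    rw [inter_self, mul_one, mul_zero, sub_zero] at h2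
    refine h1.trans ?_
    rw [ENNReal.coe_one, one_mul]
    exact h2.le
  exact ENNReal.toReal_le_of_le_ofReal hT ((iInf_le_of_le ⟨_, hpath⟩ le_rfl).trans hvar)

end PathMetric

lemma ball_subset_image_of_dense {X Z : Type*} [MetricSpace X] [MetricSpace Z] {ι : X → Z}
    (hι : Isometry ι) (hd : DenseRange ι) {N : Set X} (hN : IsCompact N) {x : X} {ε : ℝ}
    (h : ball x ε ⊆ N) : ball (ι x) ε ⊆ ι '' N := by
  intro z hz
  obtain ⟨u', hu', hu⟩ := mem_closure_iff_seq_limit.1 (hd z)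
  refine (hN.image hι.continuous).isClosed.mem_of_tendsto hu ?_
  filter_upwards [hu.eventually (isOpen_ball.mem_nhds hz)] with n hn
  obtain ⟨y, hy⟩ := hu' n
  rw [← hy] at hn ⊢
  refine mem_image_of_mem ι (h ?_)
  rwa [hι.dist_eq] at hn

end Cat2Cx

open Cat2Cx in
/-- **Lemma (convexity_lemma).**  Let `C` be a closed convex subset of `X`, `A` a
path-connected subset of `E`, and `B` the union of all `Y`-geodesics between points
of `A`.  If `A ⊆ C` then `B ⊆ C`. -/
theorem Y_geodesics_between_points_of_convex_set
    {κ : ℝ} (hκ : κ ≤ 0) {X : Type*} [MetricSpace X]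
    (PC : PolyComplex2 κ X) (hX : IsCATSpace κ X)
    (E : Set X) (hEclosed : IsClosed E) (hErc : RectConnected E) (hH1 : H1Trivial ↥E)
    (C : Set X) (hCcl : IsClosed C) (hCconv : ConvexWrt (xDist X) C)
    (A : Set X) (hAE : A ⊆ E) (hA : IsPathConnected A) (hAC : A ⊆ C) :
    (⋃ x ∈ A, ⋃ y ∈ A, geodSeg (pathDistIn E) E x y) ⊆ C := by
  refine iUnion₂_subset fun x hx => iUnion₂_subset fun y hy => iUnion₂_subset fun f hf => ?_
  rintro _ ⟨t, ht, rfl⟩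
  obtain ⟨hf0, hf1, ⟨hL, hgeo⟩, hfE⟩ := hf
  set L := pathDistIn E x y with hLdef
  have hflip : ∀ s ∈ Icc 0 L, ∀ r ∈ Icc 0 L, dist (f s) (f r) ≤ |s - r| := fun s hs r hr =>
    hgeo s hs r hr ▸ hErc.dist_le_pathDistIn (hfE hs) (hfE hr)
  have hfcont : ContinuousOn f (Icc 0 L) :=
    (LipschitzOnWith.of_dist_le_mul (K := 1) fun s hs r hr => by
      simpa [Real.dist_eq] using hflip s hs r hr).continuousOn
  obtain ⟨ε, hε, N, hN, hfN⟩ :=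
    PC.exists_thickening_subset hκ (isCompact_Icc.image_of_continuousOn hfcont)
  have hXS := hX.hasStewartPoints hκ
  let ι : X → UniformSpace.Completion X := fun x => x
  have hι : Isometry ι := UniformSpace.Completion.coe_isometry
  have hd : DenseRange ι := UniformSpace.Completion.denseRange_coe
  have hmem : ι (f t) ∈ closure (ι '' C) := by
    refine mem_convex_of_shortest (HasStewartPoints.of_dense hι hd hXS) isClosed_closure
      ((hX.stewartConvex hκ hCconv).closure_image hι hd hXS) (E := ι '' E) (N := ι '' N)
      (f := fun s => ι (f s)) (ε := ε) ?_ (hN.2.image_isometry hι) hL hε ?_ ?_ ?_ ?_ ?_ ?_ ?_ t ht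
    · rw [← image_inter hι.injective]
      exact ((hN.1.inter_left hEclosed).image hι.continuous).isClosed
    · intro s hs r hr
      rw [hι.dist_eq]
      exact hflip s hs r hr
    · exact fun s hs => mem_image_of_mem ι (hfE hs)
    · exact fun s hs => ball_subset_image_of_dense hι hd hN.1 (hfN _ (mem_image_of_mem f hs))
    · rw [hf0]
      exact subset_closure (mem_image_of_mem ι (hAC hx))
    · rw [hf1]
      exact subset_closure (mem_image_of_mem ι (hAC hy))
    · intro Φ hΦ hΦC η hη h0 h1
      refine hH1.exists_ne_exp (C := C) hL hfcont hfE ?_ (Φ := fun z => Φ (ι z))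
        (hΦ.comp hι.continuous.continuousOn (mapsTo_image ι E))
        (fun z hz hzC => hΦC _ (mem_image_of_mem ι hz) (subset_closure (mem_image_of_mem ι hzC)))
        hη h0 h1
      rw [hf0, hf1]
      exact (hA.joinedIn y hy x hx).mono (subset_inter hAE hAC)
    · intro c T hc hcE hc0 hcT hT
      choose b hbE hb using hcE
      have hbL : LipschitzWith 1 b := LipschitzWith.of_dist_le_mul fun s r => by
        rw [← hι.dist_eq, hb, hb]
        exact hc.dist_le_mul s r
      have hb0 : b 0 = x := hι.injective (by rw [hb, hc0, hf0])
      have hbT : b T = y := hι.injective (by rw [hb, hcT, hf1])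
      have := pathDistIn_le_of_lipschitz hbL hbE hT
      rwa [hb0, hbT] at this
  rw [← hCcl.closure_eq, hι.isEmbedding.isInducing.closure_eq_preimage_closure_image]
  exact hmem
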